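/- arXiv:2406.17867 — 2 statements merged into one kernel-verified Lean document; each statement's English description precedes it below -/
import Mathlib

section
/- The word 1001100110 is the unique factor of exponent exactly 5/2 in the infinite binary word q = g(p): every nonempty factor of q whose exponent equals 5/2 has length 10 and equals 1001100110. -/
/-- The finite block of length `n` occurring at position `i` in the infinite word `x`. -/
def FactorAt {A : Type*} (x : ℕ → A) (i n : ℕ) : List A :=
  (List.range n).map fun t => x (i + t)

/-- `w` is a (finite) factor of the infinite word `x`. -/
def IsFactor {A : Type*} (x : ℕ → A) (w : List A) : Prop :=
  ∃ i, w = FactorAt x i w.length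

/-- Factor complexity of an infinite word: the number of distinct factors of length `n`. -/
noncomputable def complexity {A : Type*} (x : ℕ → A) (n : ℕ) : ℕ :=
  Set.ncard {w : List A | w.length = n ∧ IsFactor x w}

/-- Factor complexity of a finite word: the number of distinct factors of length `n`. -/
noncomputable def complexityF {A : Type*} (z : List A) (n : ℕ) : ℕ :=
  Set.ncard {w : List A | w.length = n ∧ w <:+: z}

/-- `p` is a period of the finite word `y`:  `1 ≤ p ≤ |y|` and `y[j] = y[j+p]`
for all `0 ≤ j < |y| - p`. -/
def HasPeriod {A : Type*} [Inhabited A] (y : List A) (p : ℕ) : Prop :=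
  1 ≤ p ∧ p ≤ y.length ∧ ∀ j, j + p < y.length → y.getD j default = y.getD (j + p) default

/-- The smallest period of a finite word. -/
noncomputable def minPeriod {A : Type*} [Inhabited A] (y : List A) : ℕ :=
  sInf {p | HasPeriod y p}

/-- The exponent of a finite word: its length divided by its smallest period. -/
noncomputable def exponent {A : Type*} [Inhabited A] (y : List A) : ℚ :=
  (y.length : ℚ) / (minPeriod y : ℚ)

/-- The critical exponent of an infinite word: the supremum of the exponents of its
nonempty finite factors. -/
noncomputable def criticalExponent {A : Type*} [Inhabited A] (x : ℕ → A) : ENNReal :=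
  sSup {e : ENNReal | ∃ w, IsFactor x w ∧ w ≠ [] ∧ e = ENNReal.ofReal ((exponent w : ℚ) : ℝ)}

/-- The image of a finite word under a morphism given by its action on letters. -/
def mapWord {k : ℕ} {A : Type*} (σ : Fin k → List A) (w : List (Fin k)) : List A :=
  (w.map σ).flatten

/-- The image of an infinite word under a (nonerasing) morphism given by its action on
letters: the `n`-th letter of the concatenation `σ (x 0) ++ σ (x 1) ++ ⋯`. -/
def applyMorph {k : ℕ} {A : Type*} [Inhabited A] (σ : Fin k → List A) (x : ℕ → Fin k) :
    ℕ → A :=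
  fun n => (((List.range (n + 1)).map fun i => σ (x i)).flatten).getD n default

/-- The morphism `h` with `h(0) = 01`, `h(1) = 21`, `h(2) = 0`. -/
def hm : Fin 3 → List (Fin 3) := ![[0, 1], [2, 1], [0]]

/-- The morphism `g` with `g(0) = 011`, `g(1) = 0`, `g(2) = 01`. -/
def gm : Fin 3 → List (Fin 2) := ![[0, 1, 1], [0], [0, 1]]

/-- The abelian complexity of a binary infinite word at `n`: the number of distinct
values taken by the count of `0`'s among its length-`n` factors. -/
noncomputable def abelianComplexity (x : ℕ → Fin 2) (n : ℕ) : ℕ :=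
  Set.ncard {z : ℕ | ∃ i, z = (FactorAt x i n).count 0}

/-- The position in `applyMorph σ x` at which the image of the `j`-th letter of `x` starts. -/
def blockStart {k : ℕ} {A : Type*} (σ : Fin k → List A) (x : ℕ → Fin k) (j : ℕ) : ℕ :=
  (mapWord σ (FactorAt x 0 j)).length

section Morphism

variable {k : ℕ} {A : Type*}

theorem FactorAt_succ (x : ℕ → A) (i n : ℕ) :
    FactorAt x i (n + 1) = FactorAt x i n ++ [x (i + n)] := by
  simp [FactorAt, List.range_succ]

theorem FactorAt_add (x : ℕ → A) (i m n : ℕ) :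
    FactorAt x i (m + n) = FactorAt x i m ++ FactorAt x (i + m) n := by
  induction n with
  | zero => simp [FactorAt]
  | succ n ih => rw [← add_assoc, FactorAt_succ, ih, FactorAt_succ, List.append_assoc, add_assoc]

theorem length_FactorAt (x : ℕ → A) (i n : ℕ) : (FactorAt x i n).length = n := by
  simp [FactorAt]

theorem getD_FactorAt (x : ℕ → A) (d : A) {i n t : ℕ} (ht : t < n) :
    (FactorAt x i n).getD t d = x (i + t) := by
  simp [FactorAt, List.getD_eq_getElem?_getD, ht]

theorem mapWord_append (σ : Fin k → List A) (u v : List (Fin k)) :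
    mapWord σ (u ++ v) = mapWord σ u ++ mapWord σ v := by
  simp [mapWord]

theorem mapWord_singleton (σ : Fin k → List A) (a : Fin k) : mapWord σ [a] = σ a := by
  simp [mapWord]

theorem blockStart_zero (σ : Fin k → List A) (x : ℕ → Fin k) : blockStart σ x 0 = 0 := by
  simp [blockStart, FactorAt, mapWord]

theorem blockStart_add (σ : Fin k → List A) (x : ℕ → Fin k) (j n : ℕ) :
    blockStart σ x (j + n) = blockStart σ x j + (mapWord σ (FactorAt x j n)).length := by
  simp [blockStart, FactorAt_add, mapWord_append]

theorem blockStart_succ (σ : Fin k → List A) (x : ℕ → Fin k) (j : ℕ) :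
    blockStart σ x (j + 1) = blockStart σ x j + (σ (x j)).length := by
  rw [blockStart_add]
  simp [FactorAt, mapWord]

theorem blockStart_strictMono {σ : Fin k → List A} (hσ : ∀ a, 1 ≤ (σ a).length)
    (x : ℕ → Fin k) : StrictMono (blockStart σ x) :=
  strictMono_nat_of_lt_succ fun j => by
    rw [blockStart_succ]
    have := hσ (x j)
    omega

theorem applyMorph_blockStart_add_of_lt [Inhabited A] {σ : Fin k → List A} (hσ : ∀ a, 1 ≤ (σ a).length)
    (x : ℕ → Fin k) (j : ℕ) {t : ℕ} (ht : t < (σ (x j)).length) :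
    applyMorph σ x (blockStart σ x j + t) = (σ (x j)).getD t default := by
  have hj : j ≤ blockStart σ x j := (blockStart_strictMono hσ x).le_apply
  obtain ⟨r, hr⟩ : ∃ r, blockStart σ x j + t + 1 = j + 1 + r :=
    ⟨blockStart σ x j + t - j, by omega⟩
  have key : ((List.range (blockStart σ x j + t + 1)).map fun i => σ (x i)).flatten
      = mapWord σ (FactorAt x 0 j) ++ (σ (x j) ++ mapWord σ (FactorAt x (j + 1) r)) := by
    have : ((List.range (blockStart σ x j + t + 1)).map fun i => σ (x i)).flatten
        = mapWord σ (FactorAt x 0 (j + 1 + r)) := by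
      rw [hr]
      simp [mapWord, FactorAt, Function.comp_def]
    rw [this, FactorAt_add, FactorAt_succ, mapWord_append, mapWord_append, mapWord_singleton,
      List.append_assoc, zero_add, zero_add]
  unfold applyMorph
  rw [key, List.getD_append_right _ _ _ _ (by unfold blockStart; omega)]
  have : blockStart σ x j + t - (mapWord σ (FactorAt x 0 j)).length = t := by
    unfold blockStart; omega
  rw [this, List.getD_append _ _ _ _ ht]

theorem exists_eq_blockStart_add {σ : Fin k → List A} (hσ : ∀ a, 1 ≤ (σ a).length)
    (x : ℕ → Fin k) (n : ℕ) : ∃ j t, t < (σ (x j)).length ∧ n = blockStart σ x j + t := by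
  induction n with
  | zero => exact ⟨0, 0, hσ _, by simp [blockStart_zero]⟩
  | succ n ih =>
    obtain ⟨j, t, ht, rfl⟩ := ih
    rcases Nat.lt_or_ge (t + 1) (σ (x j)).length with h | h
    · exact ⟨j, t + 1, h, by omega⟩
    · exact ⟨j + 1, 0, hσ _, by rw [blockStart_succ]; omega⟩

theorem applyMorph_blockStart_add [Inhabited A] {σ : Fin k → List A} (hσ : ∀ a, 1 ≤ (σ a).length)
    (x : ℕ → Fin k) (j n : ℕ) {s : ℕ} (hs : s < (mapWord σ (FactorAt x j n)).length) :
    applyMorph σ x (blockStart σ x j + s) = (mapWord σ (FactorAt x j n)).getD s default := by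
  induction n with
  | zero => simp [FactorAt, mapWord] at hs
  | succ n ih =>
    rw [FactorAt_succ, mapWord_append, mapWord_singleton] at hs ⊢
    rcases Nat.lt_or_ge s (mapWord σ (FactorAt x j n)).length with h | h
    · rw [List.getD_append _ _ _ _ h, ih h]
    · rw [List.getD_append_right _ _ _ _ h]
      rw [List.length_append] at hs
      rw [← applyMorph_blockStart_add_of_lt hσ x (j + n) (by omega), blockStart_add]
      congr 1
      omega

theorem FactorAt_applyMorph [Inhabited A] {σ : Fin k → List A} (hσ : ∀ a, 1 ≤ (σ a).length)
    (x : ℕ → Fin k) (j n o l : ℕ) (h : o + l ≤ (mapWord σ (FactorAt x j n)).length) :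
    FactorAt (applyMorph σ x) (blockStart σ x j + o) l
      = ((mapWord σ (FactorAt x j n)).drop o).take l := by
  apply List.ext_getElem
  · simp [length_FactorAt]
    omega
  · intro t h₁ h₂
    rw [length_FactorAt] at h₁
    have := applyMorph_blockStart_add hσ x j n (s := o + t) (by omega)
    rw [List.getD_eq_getElem _ _ (by omega)] at this
    rw [List.getElem_take, List.getElem_drop, ← this]
    simp [FactorAt, add_assoc]

/-- A match of the blocks `[a, J)` with the blocks shifted by `P` keeps the distance between
block starts constant. -/
theorem blockStart_shift (σ : Fin k → List A) (x : ℕ → Fin k) {a J P : ℕ} (haJ : a ≤ J)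
    (hm : ∀ j, a ≤ j → j < J → x j = x (j + P)) :
    blockStart σ x (J + P) + blockStart σ x a = blockStart σ x (a + P) + blockStart σ x J := by
  induction J, haJ using Nat.le_induction with
  | base => rfl
  | succ J hJ ih =>
    have h₁ := ih fun j h₁ h₂ => hm j h₁ (by omega)
    have h₂ := hm J hJ (by omega)
    rw [add_right_comm J 1 P, blockStart_succ, blockStart_succ, ← h₂]
    omega

/-- A match of the blocks `[a, J)` with the blocks shifted by `P` gives a match of their images. -/
theorem applyMorph_shift [Inhabited A] {σ : Fin k → List A} (hσ : ∀ a, 1 ≤ (σ a).length) (x : ℕ → Fin k)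
    {a J P Q : ℕ} (hm : ∀ j, a ≤ j → j < J → x j = x (j + P))
    (hQ : blockStart σ x (a + P) = blockStart σ x a + Q) {t : ℕ} (hat : blockStart σ x a ≤ t)
    (htJ : t < blockStart σ x J) : applyMorph σ x t = applyMorph σ x (t + Q) := by
  obtain ⟨j, s, hs, rfl⟩ := exists_eq_blockStart_add hσ x t
  have hmono := blockStart_strictMono hσ x
  have hjJ : j < J := hmono.lt_iff_lt.1 (by omega)
  have haj : a ≤ j := by
    have : blockStart σ x a < blockStart σ x (j + 1) := by rw [blockStart_succ]; omega
    have := hmono.lt_iff_lt.1 this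
    omega
  have h₁ := blockStart_shift σ x haj fun i h₁ h₂ => hm i h₁ (by omega)
  have h₂ := hm j haj hjJ
  have h₃ : blockStart σ x j + s + Q = blockStart σ x (j + P) + s := by omega
  rw [h₃, applyMorph_blockStart_add_of_lt hσ x j hs,
    applyMorph_blockStart_add_of_lt hσ x (j + P) (h₂ ▸ hs), h₂]

end Morphism

section Counting

/-- The Parikh vector of a ternary word. -/
def parikh (w : List (Fin 3)) : Fin 3 → ℤ := fun c => w.count c

/-- The incidence matrix of `hm`, acting on Parikh vectors. -/
def hmLinear (v : Fin 3 → ℤ) : Fin 3 → ℤ := ![v 0 + v 2, v 0 + v 1, v 1]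

/-- The length of the image under `gm` of a word with a given Parikh vector. -/
def gmWeight (v : Fin 3 → ℤ) : ℤ := 3 * v 0 + v 1 + 2 * v 2

/-- The Parikh vector of the prefix of length `j`. -/
def prefixParikh (p : ℕ → Fin 3) (j : ℕ) : Fin 3 → ℤ := parikh (FactorAt p 0 j)

theorem parikh_append (u v : List (Fin 3)) : parikh (u ++ v) = parikh u + parikh v := by
  ext c
  simp [parikh]

theorem parikh_mapWord_hm (w : List (Fin 3)) : parikh (mapWord hm w) = hmLinear (parikh w) := by
  induction w with
  | nil => decide
  | cons a w ih =>
    have h₁ : mapWord hm (a :: w) = hm a ++ mapWord hm w := by simp [mapWord]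
    have h₂ : parikh (a :: w) = parikh [a] + parikh w := parikh_append [a] w
    have h₃ : ∀ a, parikh (hm a) = hmLinear (parikh [a]) := by decide
    rw [h₁, h₂, parikh_append, ih, h₃]
    ext c
    fin_cases c <;> simp [hmLinear] <;> ring

theorem length_mapWord_gm (w : List (Fin 3)) :
    ((mapWord gm w).length : ℤ) = gmWeight (parikh w) := by
  induction w with
  | nil => decide
  | cons a w ih =>
    have h₁ : mapWord gm (a :: w) = gm a ++ mapWord gm w := by simp [mapWord]
    have h₂ : parikh (a :: w) = parikh [a] + parikh w := parikh_append [a] w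
    have h₃ : ∀ a, ((gm a).length : ℤ) = gmWeight (parikh [a]) := by decide
    rw [h₁, h₂, List.length_append, Nat.cast_add, ih, h₃]
    simp only [gmWeight, Pi.add_apply]
    ring

theorem prefixParikh_add (p : ℕ → Fin 3) (i n : ℕ) :
    prefixParikh p (i + n) = prefixParikh p i + parikh (FactorAt p i n) := by
  simp [prefixParikh, FactorAt_add, parikh_append]

theorem prefixParikh_succ (p : ℕ → Fin 3) (i : ℕ) :
    prefixParikh p (i + 1) = prefixParikh p i + parikh [p i] := by
  simp [prefixParikh_add, FactorAt]

theorem blockStart_gm (p : ℕ → Fin 3) (j : ℕ) :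
    (blockStart gm p j : ℤ) = gmWeight (prefixParikh p j) :=
  length_mapWord_gm _

end Counting

theorem one_le_length_hm : ∀ a, 1 ≤ (hm a).length := by decide

theorem one_le_length_gm : ∀ a, 1 ≤ (gm a).length := by decide

section FixedPoint

variable {p : ℕ → Fin 3} (hp0 : p 0 = 0) (hpfix : applyMorph hm p = p)

/-- A prefix of the fixed point of `hm` that contains all its factors of length 12. -/
def fixPrefix : List (Fin 3) := (mapWord hm)^[7] [0]

/-- The factors of length 12 of the fixed point of `hm`. -/
def windows : List (List (Fin 3)) :=
  (List.range (fixPrefix.length - 11)).map fun i => (fixPrefix.drop i).take 12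

theorem hm_window_mem : ∀ w ∈ windows, 13 ≤ (mapWord hm w).length ∧
    ∀ o < 2, ((mapWord hm w).drop o).take 12 ∈ windows := by
  decide +kernel

include hpfix in
theorem prefixFixed (w : List (Fin 3)) (hw : w = FactorAt p 0 w.length) :
    mapWord hm w = FactorAt p 0 (mapWord hm w).length := by
  have := FactorAt_applyMorph one_le_length_hm p 0 w.length 0 (mapWord hm w).length
    (by rw [← hw]; omega)
  rw [hpfix, blockStart_zero, ← hw] at this
  simpa using this.symm

include hp0 hpfix in
theorem fixPrefix_eq : fixPrefix = FactorAt p 0 fixPrefix.length := by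
  have : ∀ k, (mapWord hm)^[k] [0] = FactorAt p 0 ((mapWord hm)^[k] [0]).length := by
    intro k
    induction k with
    | zero => simp [FactorAt, hp0]
    | succ k ih =>
      rw [Function.iterate_succ_apply']
      exact prefixFixed hpfix _ ih
  exact this 7

include hp0 hpfix in
theorem FactorAt_zero_twelve : FactorAt p 0 12 = fixPrefix.take 12 := by
  have h₁ := fixPrefix_eq hp0 hpfix
  have h₂ : fixPrefix.length = 12 + 53 := by decide +kernel
  rw [h₂, FactorAt_add] at h₁
  rw [h₁, List.take_append_of_le_length (by simp [length_FactorAt]), List.take_of_length_le]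
  simp [length_FactorAt]

include hp0 hpfix in
theorem FactorAt_mem_windows (n : ℕ) : FactorAt p n 12 ∈ windows := by
  induction n using Nat.strong_induction_on with
  | _ n ih =>
    rcases Nat.eq_zero_or_pos n with rfl | hn
    · rw [FactorAt_zero_twelve hp0 hpfix]
      decide +kernel
    obtain ⟨j, t, ht, hjt⟩ := exists_eq_blockStart_add one_le_length_hm p n
    have hjn : j < n := by
      rcases Nat.eq_zero_or_pos j with rfl | hj
      · exact hn
      have h₁ : blockStart hm p 1 = 2 := by
        rw [← zero_add 1, blockStart_succ, blockStart_zero, hp0]; rfl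
      have h₂ := (blockStart_strictMono one_le_length_hm p).add_le_nat (j - 1) 1
      rw [h₁, show j - 1 + 1 = j by omega] at h₂
      omega
    obtain ⟨h₁, h₂⟩ := hm_window_mem _ (ih j hjn)
    have ht2 : t < 2 := ht.trans_le ((by decide : ∀ a, (hm a).length ≤ 2) _)
    have h₃ := FactorAt_applyMorph one_le_length_hm p j 12 t 12 (by omega)
    rw [hpfix, ← hjt] at h₃
    rw [h₃]
    exact h₂ t ht2

include hpfix in
theorem prefixParikh_blockStart (j : ℕ) :
    prefixParikh p (blockStart hm p j) = hmLinear (prefixParikh p j) := by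
  rw [prefixParikh, prefixParikh, ← parikh_mapWord_hm,
    prefixFixed hpfix _ (by rw [length_FactorAt])]
  rfl

include hpfix in
theorem apply_blockStart (j : ℕ) : p (blockStart hm p j) = if p j = 1 then 2 else 0 := by
  have h := applyMorph_blockStart_add_of_lt one_le_length_hm p j (t := 0) (one_le_length_hm _)
  rw [hpfix, add_zero] at h
  rw [h]
  generalize p j = a
  revert a
  decide

include hpfix in
theorem apply_blockStart_succ {j : ℕ} (hj : p j ≠ 2) : p (blockStart hm p j + 1) = 1 := by
  have h := applyMorph_blockStart_add_of_lt one_le_length_hm p j (t := 1)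
    ((by decide : ∀ a : Fin 3, a ≠ 2 → 1 < (hm a).length) _ hj)
  rw [hpfix] at h
  rw [h]
  generalize p j = a at hj
  revert a
  decide

include hpfix in
theorem exists_blockStart_eq {n : ℕ} (hn : p n ≠ 1) : ∃ j, n = blockStart hm p j := by
  obtain ⟨j, t, ht, rfl⟩ := exists_eq_blockStart_add one_le_length_hm p n
  rcases Nat.eq_zero_or_pos t with rfl | h
  · exact ⟨j, rfl⟩
  have : t = 1 := by
    have := (by decide : ∀ a, (hm a).length ≤ 2) (p j)
    omega
  subst this
  refine absurd (apply_blockStart_succ hpfix ?_) hn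
  intro h2
  rw [h2] at ht
  exact absurd ht (by decide)

include hp0 hpfix in
theorem apply_ne_succ (j : ℕ) : p j ≠ p (j + 1) := by
  have h := FactorAt_mem_windows hp0 hpfix j
  have h₁ : ∀ w ∈ windows, w.getD 0 0 ≠ w.getD 1 0 := by decide +kernel
  have h₂ := h₁ _ h
  rwa [getD_FactorAt _ _ (by omega), getD_FactorAt _ _ (by omega)] at h₂

theorem blockStart_hm_succ (p : ℕ → Fin 3) (j : ℕ) :
    blockStart hm p (j + 1) = blockStart hm p j + if p j = 2 then 1 else 2 := by
  rw [blockStart_succ]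
  generalize p j = a
  congr 1
  revert a
  decide

include hpfix in
theorem apply_blockStart_succ_ne {j : ℕ} (hj : p j = 2) : p (blockStart hm p j + 1) ≠ 1 := by
  have h₁ := blockStart_hm_succ p j
  rw [if_pos hj] at h₁
  rw [← h₁, apply_blockStart hpfix]
  split_ifs <;> decide

/-- The letter by which `hm` moves the right end of a repetition outwards, depending on whether
the two mismatched letters both differ from `1`. -/
def rightShift (r : Bool) : Fin 3 → ℤ := if r then ![1, 0, 0] else 0

/-- The letter by which `hm` moves the left end of a repetition outwards, depending on whether
there are mismatched letters and, if so, on whether they both differ from `2`. -/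
def leftShift (l : Option Bool) : Fin 3 → ℤ := if l = some true then ![0, 1, 0] else 0

/-- The type of a mismatch at the right end of a repetition. -/
def rightType (a b : Fin 3) : Bool := decide (a ≠ 1 ∧ b ≠ 1)

/-- The type of a mismatch at the left end of a repetition. -/
def leftType (a b : Fin 3) : Bool := decide (a ≠ 2 ∧ b ≠ 2)

include hpfix in
theorem hm_right_end {J J' Q : ℕ} (hQ : blockStart hm p J' = blockStart hm p J + Q)
    (hne : p J ≠ p J') : ∃ u,
      (∀ t < u, p (blockStart hm p J + t) = p (blockStart hm p J + t + Q)) ∧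
      p (blockStart hm p J + u) ≠ p (blockStart hm p J + u + Q) ∧
      rightType (p (blockStart hm p J + u)) (p (blockStart hm p J + u + Q))
        = !rightType (p J) (p J') ∧
      prefixParikh p (blockStart hm p J + u)
        = prefixParikh p (blockStart hm p J) + rightShift (rightType (p J) (p J')) := by
  have h₁ := apply_blockStart hpfix J
  have h₁' := apply_blockStart hpfix J'
  have h₂ : p J ≠ 2 → _ := apply_blockStart_succ hpfix
  have h₂' : p J' ≠ 2 → _ := apply_blockStart_succ hpfix
  have h₃ : p J = 2 → _ := apply_blockStart_succ_ne hpfix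
  have h₃' : p J' = 2 → _ := apply_blockStart_succ_ne hpfix
  have hsucc := prefixParikh_succ p (blockStart hm p J)
  rw [hQ] at h₁' h₂' h₃'
  rw [add_right_comm] at h₂' h₃'
  by_cases hr : p J ≠ 1 ∧ p J' ≠ 1
  · have hrt : rightType (p J) (p J') = true := by simp [rightType, hr]
    rw [if_neg hr.1] at h₁
    rw [if_neg hr.2] at h₁'
    have hmix : (p J = 2 ∧ p J' ≠ 2) ∨ (p J ≠ 2 ∧ p J' = 2) := by
      revert hne hr
      generalize p J = a
      generalize p J' = b
      revert a b
      decide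
    refine ⟨1, ?_, ?_, ?_, ?_⟩
    · intro t ht
      obtain rfl : t = 0 := by omega
      rw [add_zero, h₁, h₁']
    · rcases hmix with ⟨h, h'⟩ | ⟨h, h'⟩
      · rw [h₂' h']; exact h₃ h
      · rw [h₂ h]; exact (h₃' h').symm
    · rw [hrt]
      rcases hmix with ⟨h, h'⟩ | ⟨h, h'⟩
      · simp [rightType, h₂' h']
      · simp [rightType, h₂ h]
    · rw [hsucc, h₁, hrt]
      congr 1
      decide
  · have hrt : rightType (p J) (p J') = false := by simpa [rightType] using hr
    refine ⟨0, by simp, ?_, ?_, by simp [hrt, rightShift]⟩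
    all_goals
      rw [add_zero, h₁, h₁', rightType] at *
      revert hne hr
      generalize p J = a
      generalize p J' = b
      revert a b
      decide

include hpfix in
theorem hm_left_end {j j' Q : ℕ} (hQ : blockStart hm p (j' + 1) = blockStart hm p (j + 1) + Q)
    (hne : p j ≠ p j') : ∃ e,
      e < blockStart hm p (j + 1) ∧
      (∀ t, e < t → t < blockStart hm p (j + 1) → p t = p (t + Q)) ∧
      p e ≠ p (e + Q) ∧ leftType (p e) (p (e + Q)) = !leftType (p j) (p j') ∧
      prefixParikh p (blockStart hm p (j + 1))
        = prefixParikh p (e + 1) + leftShift (some (leftType (p j) (p j'))) := by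
  have h₁ := apply_blockStart hpfix j
  have h₁' := apply_blockStart hpfix j'
  have h₂ : p j ≠ 2 → _ := apply_blockStart_succ hpfix
  have h₂' : p j' ≠ 2 → _ := apply_blockStart_succ hpfix
  have hs := blockStart_hm_succ p j
  have hs' := blockStart_hm_succ p j'
  by_cases hl : p j ≠ 2 ∧ p j' ≠ 2
  · have hlt : leftType (p j) (p j') = true := by simp [leftType, hl]
    rw [if_neg hl.1] at hs
    rw [if_neg hl.2] at hs'
    have hjQ : blockStart hm p j + Q = blockStart hm p j' := by omega
    have hbit : p (blockStart hm p j + 1) = p (blockStart hm p j + 1 + Q) := by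
      rw [add_right_comm, hjQ, h₂ hl.1, h₂' hl.2]
    refine ⟨blockStart hm p j, by omega, ?_, ?_, ?_, ?_⟩
    · intro t h h'
      obtain rfl : t = blockStart hm p j + 1 := by omega
      exact hbit
    · rw [hjQ, h₁, h₁']
      revert hne hl
      generalize p j = a
      generalize p j' = b
      revert a b
      decide
    · rw [hjQ, h₁, h₁', leftType, leftType]
      revert hne hl
      generalize p j = a
      generalize p j' = b
      revert a b
      decide
    · rw [hs, prefixParikh_succ p (_ + 1), h₂ hl.1, hlt]
      congr 1
      decide
  · have hlt : leftType (p j) (p j') = false := by simpa [leftType] using hl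
    have hlast : ∀ i, p (blockStart hm p (i + 1) - 1) = if p i = 2 then 0 else 1 := by
      intro i
      have hi := blockStart_hm_succ p i
      split_ifs at hi ⊢ with h
      · rw [hi, Nat.add_sub_cancel, apply_blockStart hpfix, h]; rfl
      · rw [hi, show blockStart hm p i + 2 - 1 = blockStart hm p i + 1 by omega,
          apply_blockStart_succ hpfix h]
    have hpos : 1 ≤ blockStart hm p (j + 1) := by rw [hs]; split_ifs <;> omega
    have hl₁ := hlast j
    have hl₁' := hlast j'
    rw [hQ, Nat.sub_add_comm hpos] at hl₁'
    refine ⟨blockStart hm p (j + 1) - 1, by omega, by omega, ?_, ?_, ?_⟩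
    · rw [hl₁, hl₁']
      revert hne hl
      generalize p j = a
      generalize p j' = b
      revert a b
      decide
    · rw [hl₁, hl₁', leftType, leftType]
      revert hne hl
      generalize p j = a
      generalize p j' = b
      revert a b
      decide
    · rw [hlt, Nat.sub_add_cancel hpos]
      simp [leftShift]

theorem exists_first_shift_ne {A : Type*} {x : ℕ → A} {a P : ℕ}
    (h : ∃ J, a ≤ J ∧ x J ≠ x (J + P)) :
    ∃ J, a ≤ J ∧ (∀ j, a ≤ j → j < J → x j = x (j + P)) ∧ x J ≠ x (J + P) := by
  classical
  refine ⟨Nat.find h, (Nat.find_spec h).1, fun j h₁ h₂ => ?_, (Nat.find_spec h).2⟩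
  by_contra hne
  exact Nat.find_min h h₂ ⟨h₁, hne⟩

theorem exists_first_shift_eq {A : Type*} (x : ℕ → A) (a P : ℕ) :
    ∃ b ≤ a, (∀ j, b ≤ j → j < a → x j = x (j + P)) ∧ ∀ j, j + 1 = b → x j ≠ x (j + P) := by
  induction a with
  | zero => exact ⟨0, le_rfl, by omega, by omega⟩
  | succ a ih =>
    by_cases h : x a = x (a + P)
    · obtain ⟨b, hb, h₁, h₂⟩ := ih
      refine ⟨b, by omega, fun j hj hj' => ?_, h₂⟩
      rcases Nat.lt_succ_iff_lt_or_eq.1 hj' with h' | rfl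
      · exact h₁ j hj h'
      · exact h
    · refine ⟨a + 1, le_rfl, by omega, fun j hj => ?_⟩
      obtain rfl : j = a := by omega
      exact h

include hp0 hpfix in
theorem exists_shift_ne (P : ℕ) (hP : 1 ≤ P) (i : ℕ) : ∃ J, i ≤ J ∧ p J ≠ p (J + P) := by
  induction P using Nat.strong_induction_on generalizing i with
  | _ P ih =>
    by_contra! hcon
    rcases hP.eq_or_lt with rfl | hP2
    · exact apply_ne_succ hp0 hpfix i (hcon i le_rfl)
    obtain ⟨s, hs, hs1⟩ : ∃ s, i ≤ s ∧ p s ≠ 1 := by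
      by_cases h : p i = 1
      · exact ⟨i + 1, by omega, fun h' => apply_ne_succ hp0 hpfix i (h.trans h'.symm)⟩
      · exact ⟨i, le_rfl, h⟩
    obtain ⟨a, rfl⟩ := exists_blockStart_eq hpfix hs1
    obtain ⟨b, hb⟩ := exists_blockStart_eq hpfix (hcon _ hs ▸ hs1)
    have hmono := blockStart_strictMono one_le_length_hm p
    have hab : a < b := hmono.lt_iff_lt.1 (by omega)
    obtain ⟨Q, rfl⟩ := Nat.exists_eq_add_of_lt hab
    have hQ : Q + 1 < P := by
      rcases Nat.eq_zero_or_pos Q with rfl | hQ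
      · omega
      have h₁ := hmono.add_le_nat (Q - 1) (a + 1 + 1)
      rw [show Q - 1 + (a + 1 + 1) = a + Q + 1 by omega] at h₁
      have h₂ := blockStart_hm_succ p a
      have h₃ := blockStart_hm_succ p (a + 1)
      have h₄ := apply_ne_succ hp0 hpfix a
      have h₅ : blockStart hm p a + 3 ≤ blockStart hm p (a + 1 + 1) := by
        rw [h₃, h₂]
        split_ifs <;> omega
      omega
    rw [add_assoc] at hb
    obtain ⟨J, hJ, heq, hne⟩ := exists_first_shift_ne (ih (Q + 1) hQ (by omega) a)
    have hsh := blockStart_shift hm p hJ heq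
    obtain ⟨u, -, hu, -⟩ := hm_right_end hpfix (J' := J + (Q + 1)) (Q := P) (by omega) hne
    have := hmono.monotone hJ
    exact hu (hcon _ (by omega))

end FixedPoint

section Runs

/-- The block `[i, i + n)` is a maximal block on which `x` agrees with its shift by `P`; in other
words, `[i, i + n + P)` carries a maximal repetition of period `P`. -/
structure IsRun {A : Type*} (x : ℕ → A) (i n P : ℕ) : Prop where
  left : ∀ j, j + 1 = i → x j ≠ x (j + P)
  agree : ∀ j, i ≤ j → j < i + n → x j = x (j + P)
  right : x (i + n) ≠ x (i + n + P)

theorem exists_isRun {A : Type*} {x : ℕ → A} {a P : ℕ} (h : ∃ J, a ≤ J ∧ x J ≠ x (J + P)) :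
    ∃ b m, b ≤ a ∧ a ≤ b + m ∧ IsRun x b m P := by
  obtain ⟨J, haJ, hJ, hne⟩ := exists_first_shift_ne h
  obtain ⟨b, hba, hb, hleft⟩ := exists_first_shift_eq x a P
  obtain ⟨m, rfl⟩ := Nat.exists_eq_add_of_le (hba.trans haJ)
  refine ⟨b, m, hba, haJ, hleft, fun j h₁ h₂ => ?_, hne⟩
  rcases Nat.lt_or_ge j a with h₃ | h₃
  · exact hb j h₁ h₃
  · exact hJ j h₃ h₂

/-- The type of the mismatch to the left of a run; `none` for a run that is a prefix. -/
def leftState (p : ℕ → Fin 3) (i P : ℕ) : Option Bool :=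
  if i = 0 then none else some (leftType (p (i - 1)) (p (i - 1 + P)))

theorem leftState_succ (p : ℕ → Fin 3) (i P : ℕ) :
    leftState p (i + 1) P = some (leftType (p i) (p (i + P))) := by
  simp [leftState]

/-- Ten times the correction that makes the left end of a run transform linearly under `hm`. -/
def leftDrift : Option Bool → Fin 3 → ℤ
  | none => 0
  | some true => ![6, 2, -2]
  | some false => ![4, -2, 2]

/-- Ten times the correction that makes the right end of a run transform linearly under `hm`. -/
def rightDrift : Bool → Fin 3 → ℤ
  | true => ![2, 4, 6]
  | false => ![-2, 6, 4]

/-- The defect of a run whose period has Parikh vector `U` and whose excess over the period has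
Parikh vector `V`. -/
def defect (l : Option Bool) (r : Bool) (U V : Fin 3 → ℤ) : Fin 3 → ℤ :=
  fun c => 15 * U c - 10 * V c - leftDrift l c - rightDrift r c

theorem defect_hmLinear (l : Option Bool) (r : Bool) (U V : Fin 3 → ℤ) :
    defect (l.map not) (!r) (hmLinear U) (hmLinear V + leftShift l + rightShift r)
      = hmLinear (defect l r U V) := by
  ext c
  rcases l with _ | _ | _ <;> rcases r with _ | _ <;> fin_cases c <;>
    simp [defect, hmLinear, leftShift, rightShift, leftDrift, rightDrift] <;> ring

/-- The types of the ends of a run, the Parikh vector of its period, and its defect. -/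
abbrev RunState : Type := Option Bool × Bool × (Fin 3 → ℤ) × (Fin 3 → ℤ)

/-- The state of the run `[i, i + n)` of `p` with period `P`. -/
def runState (p : ℕ → Fin 3) (i n P : ℕ) : RunState :=
  let l := leftState p i P
  let r := rightType (p (i + n)) (p (i + n + P))
  let U := prefixParikh p (i + P) - prefixParikh p i
  (l, r, U, defect l r U (prefixParikh p (i + n) - prefixParikh p i))

/-- The effect of `hm` on the state of a run. -/
def RunState.next (s : RunState) : RunState :=
  (s.1.map not, !s.2.1, hmLinear s.2.2.1, hmLinear s.2.2.2)

theorem hmLinear_sub (u v : Fin 3 → ℤ) : hmLinear (u - v) = hmLinear u - hmLinear v := by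
  ext c
  fin_cases c <;> simp [hmLinear] <;> ring

theorem prefixParikh_shift {p : ℕ → Fin 3} {i j P : ℕ} (hij : i ≤ j)
    (h : ∀ t, i ≤ t → t < j → p t = p (t + P)) :
    prefixParikh p (j + P) - prefixParikh p (i + P) = prefixParikh p j - prefixParikh p i := by
  induction j, hij using Nat.le_induction with
  | base => simp
  | succ j hj ih =>
    rw [add_right_comm, prefixParikh_succ, prefixParikh_succ, ← h j hj (by omega),
      add_sub_right_comm, ih fun t h₁ h₂ => h t h₁ (by omega), ← add_sub_right_comm]

variable {p : ℕ → Fin 3} (hp0 : p 0 = 0) (hpfix : applyMorph hm p = p)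

include hp0 hpfix in
/-- A run containing two positions is the image under `hm` of an earlier run. -/
theorem IsRun.exists_preimage {i n P : ℕ} (h : IsRun p i n P) (hn : 2 ≤ n) :
    ∃ a m Q, IsRun p a m Q ∧ a + m < i + n ∧ runState p i n P = (runState p a m Q).next := by
  have hmono := blockStart_strictMono one_le_length_hm p
  have hP : 1 ≤ P := by
    by_contra hP
    obtain rfl : P = 0 := by omega
    exact h.right rfl
  obtain ⟨s, hs, hsn, hs1⟩ : ∃ s, i ≤ s ∧ s < i + n ∧ p s ≠ 1 := by
    by_cases h1 : p i = 1
    · exact ⟨i + 1, by omega, by omega, fun h' => apply_ne_succ hp0 hpfix i (h1.trans h'.symm)⟩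
    · exact ⟨i, le_rfl, by omega, h1⟩
  obtain ⟨d, rfl⟩ := exists_blockStart_eq hpfix hs1
  obtain ⟨b, hb⟩ := exists_blockStart_eq hpfix (h.agree _ hs hsn ▸ hs1)
  have hdb : d < b := hmono.lt_iff_lt.1 (by omega)
  obtain ⟨Q, rfl⟩ := Nat.exists_eq_add_of_le hdb.le
  obtain ⟨a, m, had, hdm, hrun⟩ :=
    exists_isRun (exists_shift_ne hp0 hpfix Q (by omega) d)
  have hshift : ∀ j, a ≤ j → j ≤ a + m →
      blockStart hm p (j + Q) = blockStart hm p j + P := by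
    intro j haj hjm
    have h₁ := blockStart_shift hm p haj fun t h₁ h₂ => hrun.agree t h₁ (by omega)
    have h₂ := blockStart_shift hm p had fun t h₁ h₂ => hrun.agree t h₁ (by omega)
    omega
  have hagree : ∀ t, blockStart hm p a ≤ t → t < blockStart hm p (a + m) →
      p t = p (t + P) := by
    intro t h₁ h₂
    have := applyMorph_shift one_le_length_hm p hrun.agree (hshift a le_rfl (by omega)) h₁ h₂
    rwa [hpfix] at this
  have had' := hmono.monotone had
  have hdm' := hmono.monotone hdm
  obtain ⟨u, hu₁, hu₂, hu₃, hu₄⟩ :=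
    hm_right_end hpfix (hshift (a + m) (by omega) le_rfl) hrun.right
  have hend : i + n = blockStart hm p (a + m) + u := by
    rcases lt_trichotomy (i + n) (blockStart hm p (a + m) + u) with hlt | heq | hgt
    · refine absurd ?_ h.right
      rcases Nat.lt_or_ge (i + n) (blockStart hm p (a + m)) with h₁ | h₁
      · exact hagree _ (by omega) h₁
      · obtain ⟨t, ht⟩ := Nat.exists_eq_add_of_le h₁
        rw [ht]
        exact hu₁ t (by omega)
    · exact heq
    · exact absurd (h.agree _ (by omega) hgt) hu₂
  have hU := hmLinear_sub (prefixParikh p (a + Q)) (prefixParikh p a)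
  have hV := hmLinear_sub (prefixParikh p (a + m)) (prefixParikh p a)
  simp only [← prefixParikh_blockStart hpfix] at hU hV
  have hQa := hshift a le_rfl (by omega)
  have ham : a + m < i + n := by
    rcases Nat.eq_zero_or_pos (a + m) with h₀ | hpos
    · omega
    have h₁ : blockStart hm p 1 = 2 := by
      rw [← zero_add 1, blockStart_succ, blockStart_zero, hp0]; rfl
    have h₂ := hmono.add_le_nat (a + m - 1) 1
    rw [h₁, show a + m - 1 + 1 = a + m by omega] at h₂
    omega
  refine ⟨a, m, Q, hrun, ham, ?_⟩
  obtain ⟨hia, hl₁, hl₂⟩ : i ≤ blockStart hm p a ∧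
      leftState p i P = (leftState p a Q).map not ∧
      prefixParikh p (blockStart hm p a) = prefixParikh p i + leftShift (leftState p a Q) := by
    rcases a with _ | a
    · obtain rfl : i = 0 := by
        by_contra hi
        obtain ⟨i', rfl⟩ := Nat.exists_eq_add_one_of_ne_zero hi
        exact h.left i' rfl (hagree i' (by simp [blockStart_zero]) (by omega))
      simp [leftState, leftShift, blockStart_zero]
    · obtain ⟨e, he, he₁, he₂, he₃, he₄⟩ := hm_left_end hpfix (j := a) (j' := a + Q) (Q := P)
        (by rw [← hQa, add_right_comm]) (hrun.left a rfl)
      obtain rfl : i = e + 1 := by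
        rcases lt_trichotomy i (e + 1) with hlt | heq | hgt
        · exact absurd (h.agree e (by omega) (by omega)) he₂
        · exact heq
        · obtain ⟨i', rfl⟩ := Nat.exists_eq_add_one_of_ne_zero (show i ≠ 0 by omega)
          refine absurd ?_ (h.left i' rfl)
          rcases Nat.lt_or_ge i' (blockStart hm p (a + 1)) with h₁ | h₁
          · exact he₁ i' (by omega) h₁
          · exact hagree i' h₁ (by omega)
      refine ⟨by omega, ?_, ?_⟩
      · rw [leftState_succ, leftState_succ, he₃]; rfl
      · rw [leftState_succ, he₄]
  have hl₃ := prefixParikh_shift hia fun t h₁ h₂ => h.agree t h₁ (by omega)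
  rw [← hQa] at hl₃
  have hUeq : prefixParikh p (i + P) - prefixParikh p i
      = hmLinear (prefixParikh p (a + Q) - prefixParikh p a) := by
    rw [hU, sub_eq_sub_iff_sub_eq_sub, ← neg_sub, hl₃, neg_sub]
  have hVeq : prefixParikh p (i + n) - prefixParikh p i
      = hmLinear (prefixParikh p (a + m) - prefixParikh p a) + leftShift (leftState p a Q)
        + rightShift (rightType (p (a + m)) (p (a + m + Q))) := by
    rw [hV, hend, hu₄, hl₂]
    abel
  have hr := hu₃
  rw [← hend] at hr
  simp only [runState, RunState.next]
  rw [hl₁, hr, hUeq, hVeq, defect_hmLinear]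

/-- The states of runs with small period whose defect is not positive. -/
def exceptionalStates : List RunState :=
  [(some true, false, ![1, 0, 0], ![11, -8, -2]),
    (some true, true, ![1, 0, 0], ![7, -6, -4]),
    (some false, false, ![0, 1, 0], ![-2, 11, -6]),
    (some false, false, ![0, 0, 1], ![-2, -4, 9]),
    (some true, false, ![0, 1, 0], ![-4, 7, -2]),
    (none, false, ![1, 0, 0], ![17, -6, -4]),
    (some false, true, ![1, 1, 0], ![9, 3, -8]),
    (some true, true, ![0, 1, 1], ![-8, 9, 11]),
    (some false, false, ![1, 0, 1], ![13, -4, 9]),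
    (some false, false, ![1, 1, 0], ![13, 11, -6]),
    (some false, true, ![0, 1, 1], ![-6, 3, 7]),
    (none, true, ![1, 1, 0], ![13, 11, -6]),
    (some false, false, ![1, 1, 0], ![3, 1, -6]),
    (some true, true, ![2, 1, 0], ![22, 9, -4]),
    (some false, false, ![1, 2, 0], ![13, 26, -6]),
    (some true, false, ![0, 2, 1], ![-4, 22, 13]),
    (some true, false, ![1, 1, 1], ![1, -3, 3]),
    (some false, false, ![2, 2, 0], ![28, 26, -6]),
    (some true, true, ![1, 2, 1], ![-3, 4, 1]),
    (some false, true, ![2, 2, 1], ![4, -2, -3]),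
    (some false, false, ![2, 3, 2], ![-2, 1, 4]),
    (some true, false, ![3, 4, 2], ![1, 2, -2]),
    (some true, true, ![4, 5, 3], ![2, -1, 1]),
    (some false, true, ![5, 7, 4], ![-1, 3, 2]),
    (some false, false, ![7, 9, 5], ![3, 1, -1])]

/-- A state has positive defect or is one of the exceptional ones. -/
def RunState.Controlled (s : RunState) : Prop :=
  (∀ c, 1 ≤ s.2.2.2 c) ∨ s ∈ exceptionalStates

instance : DecidablePred RunState.Controlled := fun s =>
  inferInstanceAs (Decidable ((∀ c, 1 ≤ s.2.2.2 c) ∨ s ∈ exceptionalStates))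

theorem RunState.Controlled.next {s : RunState} (h : s.Controlled) : s.next.Controlled := by
  rcases h with h | h
  · left
    have h₀ := h 0
    have h₁ := h 1
    have h₂ := h 2
    intro c
    fin_cases c <;> simp [RunState.next, hmLinear] <;> omega
  · revert s
    decide +kernel

/-- Runs of length at most one with short period, read off from a window starting one letter
before the run. -/
theorem controlled_of_window : ∀ w ∈ windows, ∀ P < 10, ∀ n < 2,
    w.getD 0 0 ≠ w.getD P 0 → (n = 1 → w.getD 1 0 = w.getD (1 + P) 0) →
    w.getD (1 + n) 0 ≠ w.getD (1 + n + P) 0 →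
    RunState.Controlled (some (leftType (w.getD 0 0) (w.getD P 0)),
      rightType (w.getD (1 + n) 0) (w.getD (1 + n + P) 0), parikh ((w.drop 1).take P),
      defect (some (leftType (w.getD 0 0) (w.getD P 0)))
        (rightType (w.getD (1 + n) 0) (w.getD (1 + n + P) 0))
        (parikh ((w.drop 1).take P)) (parikh ((w.drop 1).take n))) := by
  decide +kernel

/-- Runs of length at most one with short period at the beginning of the fixed point. -/
theorem controlled_of_prefix : ∀ P < 10, ∀ n < 2,
    (n = 1 → fixPrefix.getD 0 0 = fixPrefix.getD P 0) →
    fixPrefix.getD n 0 ≠ fixPrefix.getD (n + P) 0 →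
    RunState.Controlled (none,
      rightType (fixPrefix.getD n 0) (fixPrefix.getD (n + P) 0), parikh (fixPrefix.take P),
      defect none (rightType (fixPrefix.getD n 0) (fixPrefix.getD (n + P) 0))
        (parikh (fixPrefix.take P)) (parikh (fixPrefix.take n))) := by
  decide +kernel

theorem two_le_count_window : ∀ w ∈ windows, ∀ c, 2 ≤ (w.take 10).count c := by
  decide +kernel

theorem FactorAt_take {A : Type*} (x : ℕ → A) {i m n : ℕ} (h : m ≤ n) :
    (FactorAt x i n).take m = FactorAt x i m := by
  obtain ⟨r, rfl⟩ := Nat.exists_eq_add_of_le h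
  rw [FactorAt_add, List.take_left' (length_FactorAt x i m)]

theorem FactorAt_drop {A : Type*} (x : ℕ → A) (i m n : ℕ) :
    (FactorAt x i (m + n)).drop m = FactorAt x (i + m) n := by
  rw [FactorAt_add, List.drop_left' (length_FactorAt x i m)]

theorem prefixParikh_sub (p : ℕ → Fin 3) (i n : ℕ) :
    prefixParikh p (i + n) - prefixParikh p i = parikh (FactorAt p i n) := by
  rw [prefixParikh_add, add_sub_cancel_left]

include hp0 hpfix in
theorem IsRun.controlled_of_short {i n P : ℕ} (h : IsRun p i n P) (hn : n < 2) :
    (runState p i n P).Controlled := by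
  simp only [runState, prefixParikh_sub]
  rcases Nat.lt_or_ge P 10 with hP | hP
  · rcases i with _ | i
    · have key := controlled_of_prefix P hP n hn
      have hlen : fixPrefix.length = 65 := by decide +kernel
      have hfix := fixPrefix_eq hp0 hpfix
      rw [hlen] at hfix
      rw [hfix, getD_FactorAt _ _ (by omega), getD_FactorAt _ _ (by omega),
        getD_FactorAt _ _ (by omega), getD_FactorAt _ _ (by omega),
        FactorAt_take _ (by omega), FactorAt_take _ (by omega)] at key
      have h₁ := h.right
      have h₂ : n = 1 → p 0 = p (0 + P) := fun hn1 => h.agree _ le_rfl (by omega)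
      simp only [zero_add] at key h₁ h₂ ⊢
      exact key h₂ h₁
    · have key := controlled_of_window _ (FactorAt_mem_windows hp0 hpfix i) P hP n hn
      rw [getD_FactorAt _ _ (by omega), getD_FactorAt _ _ (by omega), getD_FactorAt _ _ (by omega),
        getD_FactorAt _ _ (by omega), getD_FactorAt _ _ (by omega), getD_FactorAt _ _ (by omega),
        show 12 = 1 + 11 from rfl, FactorAt_drop,
        FactorAt_take _ (by omega), FactorAt_take _ (by omega)] at key
      rw [leftState_succ]
      simp only [← add_assoc, add_zero] at key
      exact key (h.left i rfl) (fun hn1 => h.agree _ le_rfl (by omega)) h.right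
  · left
    intro c
    have hU : 2 ≤ parikh (FactorAt p i P) c := by
      have h₁ := two_le_count_window _ (FactorAt_mem_windows hp0 hpfix i) c
      rw [FactorAt_take _ (by omega)] at h₁
      have h₂ := ((List.take_sublist 10 (FactorAt p i P)).count_le c)
      rw [FactorAt_take _ hP] at h₂
      simp only [parikh]
      omega
    have hV : parikh (FactorAt p i n) c ≤ 1 := by
      have h₁ := List.count_le_length (a := c) (l := FactorAt p i n)
      rw [length_FactorAt] at h₁
      simp only [parikh]
      omega
    have hl : ∀ l c, leftDrift l c ≤ 6 := by decide
    have hr : ∀ r c, rightDrift r c ≤ 6 := by decide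
    have hl' := hl (leftState p i P) c
    have hr' := hr (rightType (p (i + n)) (p (i + n + P))) c
    simp only [defect]
    omega

include hp0 hpfix in
theorem IsRun.controlled {i n P : ℕ} (h : IsRun p i n P) : (runState p i n P).Controlled := by
  induction hN : i + n using Nat.strong_induction_on generalizing i n P with
  | _ N ih =>
    rcases Nat.lt_or_ge n 2 with hn | hn
    · exact h.controlled_of_short hp0 hpfix hn
    · obtain ⟨a, m, Q, hrun, hlt, heq⟩ := h.exists_preimage hp0 hpfix hn
      rw [heq]
      exact (ih _ (hN ▸ hlt) hrun rfl).next

end Runs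

section Image

variable {p : ℕ → Fin 3}

/-- The number of letters by which `gm` extends a run to the left is at most this. -/
def leftExt (l : Option Bool) : ℕ := if l = some false then 1 else 0

/-- The number of letters by which `gm` extends a run to the right is at most this. -/
def rightExt (r : Bool) : ℕ := if r then 2 else 1

theorem applyMorph_gm_blockStart_add (p : ℕ → Fin 3) (j : ℕ) {t : ℕ}
    (ht : t ≤ (gm (p j)).length) :
    applyMorph gm p (blockStart gm p j + t) = (gm (p j) ++ [0]).getD t 0 := by
  rcases ht.lt_or_eq with h | rfl
  · rw [List.getD_append _ _ _ _ h]
    exact applyMorph_blockStart_add_of_lt one_le_length_gm p j h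
  · rw [List.getD_append_right _ _ _ _ le_rfl, ← blockStart_succ, ← add_zero (blockStart gm p _),
      applyMorph_blockStart_add_of_lt one_le_length_gm p _ (one_le_length_gm _)]
    generalize p (j + 1) = a
    generalize p j = b
    revert a b
    decide

theorem exists_blockStart_gm_eq (p : ℕ → Fin 3) {n : ℕ} (hn : applyMorph gm p n = 0) :
    ∃ j, n = blockStart gm p j := by
  obtain ⟨j, t, ht, rfl⟩ := exists_eq_blockStart_add one_le_length_gm p n
  rcases Nat.eq_zero_or_pos t with rfl | h
  · exact ⟨j, rfl⟩
  rw [applyMorph_gm_blockStart_add p j ht.le] at hn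
  have : ∀ a, ∀ t < (gm a).length, 0 < t → (gm a ++ [0]).getD t 0 ≠ 0 := by decide
  exact absurd hn (this _ t ht h)

theorem exists_applyMorph_gm_eq_zero (p : ℕ → Fin 3) (i : ℕ) :
    ∃ s, i ≤ s ∧ s ≤ i + 2 ∧ applyMorph gm p s = 0 := by
  obtain ⟨j, t, ht, rfl⟩ := exists_eq_blockStart_add one_le_length_gm p i
  have hlen : ∀ a, (gm a).length ≤ 3 ∧ (gm a ++ [0]).getD 0 0 = 0 ∧
      (gm a ++ [0]).getD (gm a).length 0 = 0 := by decide
  obtain ⟨h₁, h₂, h₃⟩ := hlen (p j)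
  rcases Nat.eq_zero_or_pos t with rfl | h
  · exact ⟨_, le_rfl, by omega, by rw [applyMorph_gm_blockStart_add p j ht.le, h₂]⟩
  · exact ⟨blockStart gm p j + (gm (p j)).length, by omega, by omega,
      by rw [applyMorph_gm_blockStart_add p j le_rfl, h₃]⟩

theorem gm_right_end {J J' Q : ℕ} (hQ : blockStart gm p J' = blockStart gm p J + Q)
    (hne : p J ≠ p J') : ∃ u ≤ rightExt (rightType (p J) (p J')),
      applyMorph gm p (blockStart gm p J + u) ≠ applyMorph gm p (blockStart gm p J + u + Q) := by
  have key : ∀ a b, a ≠ b → ∃ u ≤ rightExt (rightType a b), u ≤ (gm a).length ∧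
      u ≤ (gm b).length ∧ (gm a ++ [0]).getD u 0 ≠ (gm b ++ [0]).getD u 0 := by decide
  obtain ⟨u, hu, ha, hb, h⟩ := key _ _ hne
  refine ⟨u, hu, ?_⟩
  rwa [add_right_comm, ← hQ, applyMorph_gm_blockStart_add p J ha,
    applyMorph_gm_blockStart_add p J' hb]

theorem gm_left_end {j j' Q : ℕ} (hQ : blockStart gm p (j' + 1) = blockStart gm p (j + 1) + Q)
    (hne : p j ≠ p j') : ∃ e < blockStart gm p (j + 1),
      blockStart gm p (j + 1) ≤ e + 1 + leftExt (some (leftType (p j) (p j'))) ∧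
      applyMorph gm p e ≠ applyMorph gm p (e + Q) := by
  have key : ∀ a b, a ≠ b → ∃ v ≤ leftExt (some (leftType a b)), v < (gm a).length ∧
      v < (gm b).length ∧
      (gm a ++ [0]).getD ((gm a).length - 1 - v) 0
        ≠ (gm b ++ [0]).getD ((gm b).length - 1 - v) 0 := by decide
  obtain ⟨v, hv, ha, hb, h⟩ := key _ _ hne
  have h₁ := blockStart_succ gm p j
  have h₁' := blockStart_succ gm p j'
  refine ⟨blockStart gm p j + ((gm (p j)).length - 1 - v), by omega, by omega, ?_⟩
  rwa [show blockStart gm p j + ((gm (p j)).length - 1 - v) + Q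
      = blockStart gm p j' + ((gm (p j')).length - 1 - v) by omega,
    applyMorph_gm_blockStart_add p j (by omega), applyMorph_gm_blockStart_add p j' (by omega)]

variable (hp0 : p 0 = 0) (hpfix : applyMorph hm p = p)

include hp0 hpfix in
/-- A repetition of the image under `gm` comes from a run of the fixed point of `hm`. -/
theorem exists_run_of_gm_repetition {i n P : ℕ} (hP : 1 ≤ P) (hn : 3 ≤ n)
    (h : ∀ j, i ≤ j → j < i + n → applyMorph gm p j = applyMorph gm p (j + P)) :
    ∃ a m Q, IsRun p a m Q ∧
      (P : ℤ) = gmWeight (prefixParikh p (a + Q) - prefixParikh p a) ∧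
      (n : ℤ) ≤ gmWeight (prefixParikh p (a + m) - prefixParikh p a)
        + leftExt (leftState p a Q) + rightExt (rightType (p (a + m)) (p (a + m + Q))) := by
  have hmono := blockStart_strictMono one_le_length_gm p
  obtain ⟨s, his, hsi, hs⟩ := exists_applyMorph_gm_eq_zero p i
  have hsn : s < i + n := by omega
  obtain ⟨d, rfl⟩ := exists_blockStart_gm_eq p hs
  obtain ⟨b, hb⟩ := exists_blockStart_gm_eq p (h _ his hsn ▸ hs)
  have hdb : d < b := hmono.lt_iff_lt.1 (by omega)
  obtain ⟨Q, rfl⟩ := Nat.exists_eq_add_of_le hdb.le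
  obtain ⟨a, m, had, hdm, hrun⟩ :=
    exists_isRun (exists_shift_ne hp0 hpfix Q (by omega) d)
  have hshift : ∀ j, a ≤ j → j ≤ a + m →
      blockStart gm p (j + Q) = blockStart gm p j + P := by
    intro j haj hjm
    have h₁ := blockStart_shift gm p haj fun t h₁ h₂ => hrun.agree t h₁ (by omega)
    have h₂ := blockStart_shift gm p had fun t h₁ h₂ => hrun.agree t h₁ (by omega)
    omega
  have had' := hmono.monotone had
  have hdm' := hmono.monotone hdm
  have hQa := hshift a le_rfl (by omega)
  obtain ⟨u, hu, hune⟩ := gm_right_end (hshift (a + m) (by omega) le_rfl) hrun.right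
  have hend : i + n ≤ blockStart gm p (a + m) + u := by
    by_contra hlt
    exact hune (h _ (by omega) (by omega))
  have hstart : blockStart gm p a ≤ i + leftExt (leftState p a Q) := by
    rcases a with _ | a
    · simp [blockStart_zero]
    · obtain ⟨e, he, he', hne⟩ := gm_left_end (j := a) (j' := a + Q) (Q := P)
        (by rw [← hQa, add_right_comm]) (hrun.left a rfl)
      rw [leftState_succ]
      have : e < i := by
        by_contra hei
        exact hne (h e (by omega) (by omega))
      omega
  have hsub : ∀ u v, gmWeight (u - v) = gmWeight u - gmWeight v := by
    intro u v
    simp only [gmWeight, Pi.sub_apply]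
    ring
  refine ⟨a, m, Q, hrun, ?_, ?_⟩
  · rw [hsub, ← blockStart_gm, ← blockStart_gm]
    omega
  · rw [hsub, ← blockStart_gm, ← blockStart_gm]
    omega

theorem gmWeight_defect (l : Option Bool) (r : Bool) (U V : Fin 3 → ℤ) :
    gmWeight (defect l r U V) = 15 * gmWeight U - 10 * gmWeight V - gmWeight (leftDrift l)
      - gmWeight (rightDrift r) := by
  simp only [gmWeight, defect]
  ring

/-- A controlled state gives exponent at least `5 / 2` in the image under `gm` only for the
periods `1` and `4`. -/
theorem RunState.Controlled.gmWeight_eq {l : Option Bool} {r : Bool} {U V : Fin 3 → ℤ}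
    (h : RunState.Controlled (l, r, U, defect l r U V))
    (hV : 3 * gmWeight U ≤ 2 * (gmWeight V + leftExt l + rightExt r)) :
    gmWeight U = 4 ∨ gmWeight U = 1 := by
  have hd := gmWeight_defect l r U V
  rcases h with h | h
  · have h₀ := h 0
    have h₁ := h 1
    have h₂ := h 2
    have hext : ∀ l r, 10 * ((leftExt l : ℤ) + rightExt r) - gmWeight (leftDrift l)
        - gmWeight (rightDrift r) < 6 := by decide
    have := hext l r
    simp only at h₀ h₁ h₂
    rw [gmWeight] at hd
    omega
  · have hexc : ∀ s ∈ exceptionalStates,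
        10 * ((leftExt s.1 : ℤ) + rightExt s.2.1) - gmWeight (leftDrift s.1)
          - gmWeight (rightDrift s.2.1) < gmWeight s.2.2.2 ∨
        gmWeight s.2.2.1 = 4 ∨ gmWeight s.2.2.1 = 1 := by decide +kernel
    rcases hexc _ h with h | h
    · simp only at h
      omega
    · exact h

theorem gm_window_eq : ∀ w ∈ windows, ∀ o < 3,
    (∀ t < 6, (((mapWord gm w).drop o).take 10).getD t 0
      = (((mapWord gm w).drop o).take 10).getD (t + 4) 0) →
    ((mapWord gm w).drop o).take 10 = [1, 0, 0, 1, 1, 0, 0, 1, 1, 0] := by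
  decide +kernel

theorem length_gm_window : ∀ w ∈ windows, 13 ≤ (mapWord gm w).length := by
  decide +kernel

end Image

theorem hasPeriod_minPeriod {A : Type*} [Inhabited A] {w : List A} (hw : w ≠ []) :
    HasPeriod w (minPeriod w) :=
  Nat.sInf_mem (s := {p | HasPeriod w p})
    ⟨w.length, List.length_pos_iff.2 hw, le_rfl, fun j hj => by omega⟩

/-- The word `1001100110` is the unique factor of `q = g(p)` of exponent exactly `5/2`. -/
theorem stmt10 (p : ℕ → Fin 3) (hp0 : p 0 = 0) (hpfix : applyMorph hm p = p) :
    ∀ w : List (Fin 2), IsFactor (applyMorph gm p) w → w ≠ [] → exponent w = 5 / 2 →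
      w = ([1, 0, 0, 1, 1, 0, 0, 1, 1, 0] : List (Fin 2)) := by
  rintro w ⟨i, hw⟩ hne hexp
  obtain ⟨hP, -, hper⟩ := hasPeriod_minPeriod hne
  have hlen : 2 * w.length = 5 * minPeriod w := by
    have hpos : (0 : ℚ) < minPeriod w := by exact_mod_cast hP
    rw [exponent, div_eq_div_iff hpos.ne' two_ne_zero] at hexp
    have : w.length * 2 = 5 * minPeriod w := by exact_mod_cast hexp
    omega
  obtain ⟨k, hk⟩ : ∃ k, minPeriod w = 2 * k := ⟨minPeriod w / 2, by omega⟩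
  rw [hk] at hP hlen hper
  have hwl : w.length = 5 * k := by omega
  rw [hwl] at hw hper
  have hrep : ∀ j, i ≤ j → j < i + 3 * k →
      applyMorph gm p j = applyMorph gm p (j + 2 * k) := by
    intro j h₁ h₂
    obtain ⟨t, rfl⟩ := Nat.exists_eq_add_of_le h₁
    have := hper t (by omega)
    rwa [hw, getD_FactorAt _ _ (by omega), getD_FactorAt _ _ (by omega), ← add_assoc] at this
  obtain ⟨a, m, Q, hrun, hU, hV⟩ :=
    exists_run_of_gm_repetition hp0 hpfix (by omega) (by omega) hrep
  have hk2 : k = 2 := by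
    have := (hrun.controlled hp0 hpfix).gmWeight_eq (by push_cast at hU hV; omega)
    omega
  subst hk2
  obtain ⟨j, o, ho, rfl⟩ := exists_eq_blockStart_add one_le_length_gm p i
  have ho3 : o < 3 := ho.trans_le ((by decide : ∀ a, (gm a).length ≤ 3) _)
  have hwin := FactorAt_mem_windows hp0 hpfix j
  rw [FactorAt_applyMorph one_le_length_gm p j 12 o _
    (by have := length_gm_window _ hwin; omega)] at hw
  rw [hw]
  refine gm_window_eq _ hwin o ho3 fun t ht => ?_
  have := hper t (by omega)
  rwa [hw] at this
end

section
/- For every n ≥ 1, the set of possible counts of 0's among the length-n factors of the infinite binary word q = g(p) never contains two values x and y with y = x + 4; equivalently, the abelian complexity of q never takes the value 5 or more. -/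
/-- A code for the unordered pair of letters `a`, `b`. -/
def pairCode (a b : Fin 3) : ℕ :=
  a.val * b.val + a.val + b.val

/-- Pairs of transitions of the prefix automaton of `h`, which leads from a letter `a`, reading a
proper prefix of `h(a)`, to the letter following that prefix. They are grouped by the total numbers
of `0`'s and of `2`'s that they read, and given by the codes of the source and of the target. -/
def pairTransitions : List ((ℕ × ℕ) × List (ℕ × ℕ)) :=
  [((0, 0), [(0, 0), (1, 2), (2, 0), (3, 8), (5, 2), (8, 0)]),
   ((1, 0), [(0, 1), (1, 5), (2, 1)]),
   ((0, 1), [(1, 1), (3, 5), (5, 1)]),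
   ((2, 0), [(0, 3)]),
   ((1, 1), [(1, 3)]),
   ((0, 2), [(3, 3)])]

/-- Pairs of proper prefixes of words `g(a)`, grouped by their total length and their total number
of `0`'s, and given by the code of the pair of letters. -/
def pairCodingPrefixes : List ((ℕ × ℕ) × List ℕ) :=
  [((0, 0), [0, 1, 2, 3, 5, 8]),
   ((1, 1), [0, 1, 2, 5, 8]),
   ((2, 1), [0, 1, 2]),
   ((2, 2), [0, 2, 8]),
   ((3, 2), [0, 2]),
   ((4, 2), [0])]

/-- An integer relaxation of the condition that the dominant eigenform of the incidence matrix
of `h` takes a value of absolute value at most `13` at `(x - 20, y - 20, z - 20)`. -/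
def nearKernel (x y z : ℕ) : Bool :=
  Nat.ble 6859100 (175488 * x + 132472 * y + 100000 * z) &&
    Nat.ble (175488 * x + 132472 * y + 100000 * z) 9459300

/-- The part of the table of reachable vectors with first coordinate `-5`. -/
def reachableRows15 : List (ℕ × List (ℕ × ℕ)) :=
  [(17, [(20, 147712)]),
   (18, [(19, 296), (20, 288)])]

/-- The part of the table of reachable vectors with first coordinate `-4`. -/
def reachableRows16 : List (ℕ × List (ℕ × ℕ)) :=
  [(16, [(20, 40533903616)]),
   (17, [(18, 1397820480336791019869487), (19, 1208925830029208761031983), (20, 9007238983343396), (21, 34359738368)]),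
   (18, [(17, 2097192), (18, 37778931862957172199722), (19, 281475054326062), (20, 1141002542), (21, 131072)]),
   (19, [(18, 8), (19, 2097192), (20, 4392), (21, 256)]),
   (20, [(20, 8)])]

/-- The part of the table of reachable vectors with first coordinate `-3`. -/
def reachableRows17 : List (ℕ × List (ℕ × ℕ)) :=
  [(15, [(19, 9183161783291393), (20, 35030827008)]),
   (16, [(18, 1393098123107450828513063), (19, 1208925829994059677458183), (20, 9007238849104384), (21, 34359738368)]),
   (17, [(17, 1426154679304377635460143), (18, 1426154688452318942093103), (19, 1378931023623657384468271), (20, 10273877250952965), (21, 39191707648)]),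
   (18, [(16, 37778931862957163806728), (17, 188894659596260796272682), (18, 1407265213302530310165807), (19, 1397820489414363313757487), (20, 10414614211878183), (21, 39728597248)]),
   (19, [(17, 2097160), (18, 37778931862957172199466), (19, 188894659596260863398190), (20, 1407376035042606), (21, 5368860964)]),
   (20, [(18, 8), (19, 2097192), (20, 10490154), (21, 20776)]),
   (21, [(20, 8), (21, 40)])]

/-- The part of the table of reachable vectors with first coordinate `-2`. -/
def reachableRows18 : List (ℕ × List (ℕ × ℕ)) :=
  [(14, [(19, 671088640)]),
   (15, [(18, 1232537662408407836265985), (19, 9183160709417472), (20, 35030827008)]),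
   (16, [(16, 221951226172618029405185), (17, 1430877054970373026373123), (18, 1393098123107450826415623), (19, 1227815295925538258308613), (20, 9147976337459712), (21, 34896609280)]),
   (17, [(15, 37778931862957161709568), (16, 198339392562000078311426), (17, 1430877045822431854089743), (18, 1430877054970373630484015), (19, 1393098123107450826415911), (20, 10379430502485765), (21, 39594362880)]),
   (18, [(16, 37778931862957163806728), (17, 198339392632369904882731), (18, 1430877045927989332434735), (19, 1426154688487538210791215), (20, 1208925830240350290992935), (21, 9007239788646148), (22, 34359738368)]),
   (19, [(17, 37778932144432141045770), (18, 198339393687901068350511), (19, 1426154688311581185301807), (20, 1360041557692178268577583), (21, 10133139762601255), (22, 38654836736)]),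
   (20, [(17, 2097160), (18, 37778931862957172199466), (19, 188894659596260863398190), (20, 1397820480336791019869487), (21, 10414579582655790), (22, 39728595200)]),
   (21, [(18, 8), (19, 2097192), (20, 10490154), (21, 77615406), (22, 151840)]),
   (22, [(20, 8), (21, 40), (22, 296)])]

/-- The part of the table of reachable vectors with first coordinate `-1`. -/
def reachableRows19 : List (ℕ × List (ℕ × ℕ)) :=
  [(14, [(17, 35184506306560), (18, 134217728)]),
   (15, [(16, 14167099554162454560768), (17, 23611832660639770477056), (18, 175922799968768), (19, 671088640)]),
   (16, [(16, 51946031698595532767232), (17, 184172294485587960530432), (18, 1232537662408407836265985), (19, 9183160709417472), (20, 35030827008)]),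
   (17, [(16, 51946031663410892505088), (17, 221951226348544454301185), (18, 1393098123107450759175683), (19, 1232537662408407903522309), (20, 9183160709548544), (21, 35030827008)]),
   (18, [(16, 47223665110171430944768), (17, 221951226172618037793795), (18, 1430877054970372959264271), (19, 1393098123107450826415655), (20, 1227815295925538258308869), (21, 9147976337459712), (22, 34896609280)]),
   (19, [(16, 37778931862957161709568), (17, 198339392562000078311434), (18, 1430877045787247213564975), (19, 1430877054970372959395631), (20, 1388375756624581181202215), (21, 10344246130396933), (22, 39460145152)]),
   (20, [(17, 37778931862957163806728), (18, 198339392562000086700074), (19, 1426154679304377635460399), (20, 1426154688452318942093103), (21, 1208925830240350156513063), (22, 9007239788645636), (23, 34359738368)]),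
   (21, [(18, 37778931862957163806728), (19, 188894659596260796272682), (20, 1397820480336791019738415), (21, 1360041557481037407870255), (22, 10133138957294886), (23, 38654836736)]),
   (22, [(19, 2097160), (20, 37778931862957172199466), (21, 281475054326062), (22, 1149391150), (23, 147712)]),
   (23, [(20, 8), (21, 2097192), (22, 4392), (23, 288)]),
   (24, [(22, 8)])]

/-- The part of the table of reachable vectors with first coordinate `0`. -/
def reachableRows20 : List (ℕ × List (ℕ × ℕ)) :=
  [(15, [(17, 35184506306560), (18, 134217728)]),
   (16, [(16, 4722366482869645213696), (17, 4722366588423164133376), (18, 4722366658792445182464), (19, 35185043177472), (20, 134217728)]),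
   (17, [(16, 9444732965739290427392), (17, 33056565767116951912960), (18, 33056566752284336457216), (19, 23611841667877679925760), (20, 175957159707136), (21, 671088640)]),
   (18, [(16, 37778931862957161709568), (17, 203061759115239539606528), (18, 1430877045963173761129985), (19, 1393098123107450750782977), (20, 1232537662408407836397057), (21, 9183160709417472), (22, 35030827008)]),
   (19, [(17, 47223665110171431473152), (18, 221951226207802679383555), (19, 1430877054970373630483975), (20, 1393098123107450826415623), (21, 10379430502747653), (22, 39594363392)]),
   (20, [(17, 37778931862957163806720), (18, 203061759115239550096395), (19, 1430877045963173704523311), (20, 1430877054970407990222639), (21, 1227815296207013243936551), (22, 9147977411219205), (23, 34896609280)]),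
   (21, [(18, 47223665110171431473162), (19, 217228859689748393645103), (20, 1426154688452318942093103), (21, 1388375756589396676992815), (22, 10344245996183335), (23, 39460145152)]),
   (22, [(18, 37778931862957163806728), (19, 188894659596260796272682), (20, 1407265213302530310165807), (21, 1397820489414363313757487), (22, 1208925830029243387108655), (23, 9007238983339268), (24, 34359738368)]),
   (23, [(19, 2097160), (20, 37778931862957172199466), (21, 188894659596260863398190), (22, 1407376035042606), (23, 5435969830), (24, 131072)]),
   (24, [(20, 8), (21, 2097192), (22, 10490154), (23, 20776), (24, 256)]),
   (25, [(22, 8), (23, 40)])]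

/-- The part of the table of reachable vectors with first coordinate `1`. -/
def reachableRows21 : List (ℕ × List (ℕ × ℕ)) :=
  [(16, [(18, 134217728)]),
   (17, [(17, 4722366518054017302528), (18, 4722366518054419955712), (19, 35185043177472), (20, 134217728)]),
   (18, [(17, 14167099518977679818752), (18, 33056565626379597775360), (19, 23611832660644065444352), (20, 175957159707136), (21, 671088640)]),
   (19, [(17, 47223665110171428847616), (18, 221951226207802667828736), (19, 1393098123107416391028225), (20, 1232537662408407836265985), (21, 9183160709417472), (22, 35030827008)]),
   (20, [(17, 37778931862957161709568), (18, 203061759115239541707776), (19, 1430877045963173637414403), (20, 1393098123107450826415623), (21, 1232537662408407903522309), (22, 9183160709548544), (23, 35030827008)]),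
   (21, [(18, 47223665110171431473152), (19, 221951226172618038858763), (20, 1430877054970372959395375), (21, 1393098123107450826415911), (22, 1208925829994059677454085), (23, 9007238849104384), (24, 34359738368)]),
   (22, [(18, 37778931862957163806720), (19, 198339392562000086700042), (20, 1430877045787247280673839), (21, 1426154688487503314181935), (22, 1378931023623657518685991), (23, 10273877250952965), (24, 39191707648)]),
   (23, [(19, 37778931862957163806728), (20, 198339392562000086700074), (21, 1426154679304377635460399), (22, 1397820489555101070548783), (23, 10414614748749095), (24, 39728597248)]),
   (24, [(20, 37778931862957163806728), (21, 188894659596260796272682), (22, 1397820480336791019738415), (23, 10414579584752942), (24, 39728599332)]),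
   (25, [(21, 2097160), (22, 10489898), (23, 77615406), (24, 151848)]),
   (26, [(22, 8), (23, 40)])]

/-- The part of the table of reachable vectors with first coordinate `2`. -/
def reachableRows22 : List (ℕ × List (ℕ × ℕ)) :=
  [(18, [(18, 4722366518054151520256), (19, 35184506306560), (20, 134217728)]),
   (19, [(18, 14167099554162320343040), (19, 23611832660639770477056), (20, 4722366658792445182464), (21, 35185043177472), (22, 134217728)]),
   (20, [(18, 51946031663410891980800), (19, 184172294485587423659520), (20, 1241982395374147126693377), (21, 23611841667877679925760), (22, 175957159707136), (23, 671088640)]),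
   (21, [(18, 47223665110171428847616), (19, 221951226207802669929985), (20, 1430877054970373561146883), (21, 1393098123107450818022917), (22, 10379430435622401), (23, 39594232320)]),
   (22, [(18, 37778931862957161709568), (19, 203061759115239541707778), (20, 1430877045963173637414415), (21, 1430877054970407990222375), (22, 1232537662689882889150215), (23, 9183161783307781), (24, 35030827008)]),
   (23, [(19, 47223665110171431473160), (20, 221951226172618038858795), (21, 1430877054970372959395631), (22, 1388375756624581183299375), (23, 1208925829958875305369383), (24, 9007238714886656), (25, 34359738368)]),
   (24, [(19, 37778931862957163806720), (20, 198339392562000086700042), (21, 1426154679304377635460143), (22, 1426154688452318942093103), (23, 1360041557692178803351343), (24, 10133139762597125)]),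
   (25, [(20, 37778931862957163806728), (21, 188894659596260796272682), (22, 1397820480336791019738415)]),
   (26, [(21, 2097160)])]

/-- The part of the table of reachable vectors with first coordinate `3`. -/
def reachableRows23 : List (ℕ × List (ℕ × ℕ)) :=
  [(19, [(19, 35184506306560), (20, 134217728)]),
   (20, [(19, 4722366588423164133376), (20, 4722366658792445182464), (21, 35185043177472), (22, 134217728)]),
   (21, [(19, 14167099835638371057664), (20, 33056566752284336457216), (21, 23611841667877679925760), (22, 175957159707136), (23, 671088640)]),
   (22, [(19, 51946031663410892505088), (20, 221951226348544452204033), (21, 1393098123107450750782977), (22, 1232537662408407836397057), (23, 9183160709417472), (24, 35030827008)]),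
   (23, [(19, 47223665110171430944768), (20, 221951226172618037793795), (21, 1430877054970373093481991), (22, 1393098123107450826415623), (23, 1227815295925538258308613)]),
   (24, [(19, 37778931862957161709568), (20, 198339392562000078311434), (21, 1430877045787247482000943), (22, 1430877054970373496266543)]),
   (25, [(20, 37778931862957163806728), (21, 198339392562001160442923)])]

/-- The part of the table of reachable vectors with first coordinate `4`. -/
def reachableRows24 : List (ℕ × List (ℕ × ℕ)) :=
  [(20, [(20, 134217728)]),
   (21, [(19, 4722366482869645213696), (20, 4722366518054419955712), (21, 35185043177472), (22, 134217728)]),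
   (22, [(19, 9444732965739290427392), (20, 33056565485642109420032), (21, 23611832660644065444352), (22, 4722366658826804920832), (23, 35185043177472)]),
   (23, [(19, 37778931862957161709568), (20, 203061759150424180130816), (21, 1393098114100217136287233), (22, 1241982395374147126693377)]),
   (24, [(20, 51946031663410894606336)])]

/-- The part of the table of reachable vectors with first coordinate `5`. -/
def reachableRows25 : List (ℕ × List (ℕ × ℕ)) :=
  [(22, [(20, 4722366518054017302528), (21, 4722366518054151520256)]),
   (23, [(20, 14167099518977679818752)])]

/-- The reachable combinations of Parikh vectors satisfying `nearKernel`, each with the bit mask of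
the quadruples of letters that can accompany it. -/
def reachableTable : List (ℕ × List (ℕ × List (ℕ × ℕ))) :=
  [(15, reachableRows15), (16, reachableRows16), (17, reachableRows17), (18, reachableRows18), (19, reachableRows19), (20, reachableRows20), (21, reachableRows21), (22, reachableRows22), (23, reachableRows23), (24, reachableRows24), (25, reachableRows25)]

/-- The bit mask attached to `(x - 20, y - 20, z - 20)` by `reachableTable`. -/
def reachableMask (x y z : ℕ) : ℕ :=
  match reachableTable.lookup x with
  | some r => match r.lookup y with
    | some c => match c.lookup z with
      | some m => m
      | none => 0
    | none => 0
  | none => 0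

/-- The bit at position `9 * a + b` of `m`. -/
def pairBit (m a b : ℕ) : Bool :=
  Nat.beq (Nat.mod (Nat.shiftRight m (Nat.add (Nat.mul 9 a) b)) 2) 1

/-- Closure of one table entry under the transitions. -/
def closedEntry (x y z m : ℕ) : Bool :=
  pairTransitions.all fun s => pairTransitions.all fun t =>
    bif nearKernel (x + z + s.1.1 - (t.1.1 + 20)) (x + y - 20) (y + s.1.2 - t.1.2) then
      s.2.all fun a => t.2.all fun b =>
        bif pairBit m a.1 b.1 then
          pairBit (reachableMask (x + z + s.1.1 - (t.1.1 + 20)) (x + y - 20) (y + s.1.2 - t.1.2))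
            a.2 b.2
        else true
    else true

/-- The bound on the difference of the numbers of `0`'s at one table entry. -/
def balancedEntry (x y z m : ℕ) : Bool :=
  bif Nat.ble 116 (3 * x + y + 2 * z) && Nat.ble (3 * x + y + 2 * z) 124 then
    pairCodingPrefixes.all fun s => pairCodingPrefixes.all fun t =>
      bif Nat.beq (3 * x + y + 2 * z + s.1.1) (120 + t.1.1) then
        Nat.ble (x + y + z + s.1.2) (63 + t.1.2) ||
          s.2.all fun a => t.2.all fun b => !(pairBit m a b)
      else true
  else true

/-- All coordinates occurring in the table are between `-6` and `6`. -/
def boundedEntry (x y z : ℕ) : Bool :=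
  [x, y, z].all fun t => Nat.ble 14 t && Nat.ble t 26

theorem boundedEntry_reachableTable :
    (reachableTable.all fun r => r.2.all fun c => c.2.all fun e =>
      boundedEntry r.1 c.1 e.1) = true := by
  decide +kernel

theorem closedEntry_reachableTable :
    (reachableTable.all fun r => r.2.all fun c => c.2.all fun e =>
      closedEntry r.1 c.1 e.1 e.2) = true := by
  decide +kernel

theorem balancedEntry_reachableTable :
    (reachableTable.all fun r => r.2.all fun c => c.2.all fun e =>
      balancedEntry r.1 c.1 e.1 e.2) = true := by
  decide +kernel

theorem exists_mem_of_pairBit_reachableMask {x y z a b : ℕ}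
    (hbit : pairBit (reachableMask x y z) a b = true) :
    ∃ r ∈ reachableTable, ∃ c ∈ r.2, ∃ e ∈ c.2,
      r.1 = x ∧ c.1 = y ∧ e.1 = z ∧ e.2 = reachableMask x y z := by
  have hzero : pairBit 0 a b = false := by
    have h : Nat.shiftRight 0 (Nat.add (Nat.mul 9 a) b) = 0 := Nat.zero_shiftRight _
    rw [pairBit, h]
    rfl
  have lookup_mem : ∀ {β : Type} {l : List (ℕ × β)} {k : ℕ} {v : β},
      l.lookup k = some v → (k, v) ∈ l := by
    intro β l k v h
    obtain ⟨l₁, l₂, h, -⟩ := List.lookup_eq_some_iff.1 h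
    simp [h]
  unfold reachableMask at hbit ⊢
  split at hbit
  · next r hr =>
    split at hbit
    · next c hc =>
      split at hbit
      · next m hm => exact ⟨_, lookup_mem hr, _, lookup_mem hc, _, lookup_mem hm, rfl, rfl, rfl, rfl⟩
      · simp [hzero] at hbit
    · simp [hzero] at hbit
  · simp [hzero] at hbit

/-- The vector `(x, y, z)` together with two pairs of letters, given by their codes, is recorded
in `reachableTable`. -/
def Reachable (x y z : ℤ) (a b : ℕ) : Prop :=
  ∃ x' y' z' : ℕ, (x' : ℤ) = x + 20 ∧ (y' : ℤ) = y + 20 ∧ (z' : ℤ) = z + 20 ∧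
    pairBit (reachableMask x' y' z') a b = true

theorem Reachable.zero : Reachable 0 0 0 0 0 :=
  ⟨20, 20, 20, by norm_num, by norm_num, by norm_num, by decide +kernel⟩

theorem bounds_of_pairBit_reachableMask {x y z a b : ℕ}
    (hbit : pairBit (reachableMask x y z) a b = true) :
    (14 ≤ x ∧ x ≤ 26) ∧ (14 ≤ y ∧ y ≤ 26) ∧ (14 ≤ z ∧ z ≤ 26) := by
  obtain ⟨r, hr, c, hc, e, he, rfl, rfl, rfl, -⟩ := exists_mem_of_pairBit_reachableMask hbit
  have h := List.all_eq_true.1 (List.all_eq_true.1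
    (List.all_eq_true.1 boundedEntry_reachableTable r hr) c hc) e he
  simpa [boundedEntry] using h

theorem pairTransitions_sum_le {u : (ℕ × ℕ) × List (ℕ × ℕ)} (hu : u ∈ pairTransitions) :
    u.1.1 + u.1.2 ≤ 2 := by
  have h : ∀ u ∈ pairTransitions, u.1.1 + u.1.2 ≤ 2 := by decide
  exact h u hu

theorem pairCodingPrefixes_length_le {u : (ℕ × ℕ) × List ℕ} (hu : u ∈ pairCodingPrefixes) :
    u.1.1 ≤ 4 := by
  have h : ∀ u ∈ pairCodingPrefixes, u.1.1 ≤ 4 := by decide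
  exact h u hu

theorem Reachable.bounds {x y z : ℤ} {a b : ℕ} (h : Reachable x y z a b) :
    |x| ≤ 6 ∧ |y| ≤ 6 ∧ |z| ≤ 6 := by
  obtain ⟨x', y', z', hx, hy, hz, hbit⟩ := h
  have := bounds_of_pairBit_reachableMask hbit
  simp only [abs_le]
  omega

theorem Reachable.step {x y z : ℤ} {a b a' b' : ℕ} (h : Reachable x y z a b)
    {s t : (ℕ × ℕ) × List (ℕ × ℕ)} (hs : s ∈ pairTransitions) (ht : t ∈ pairTransitions)
    (ha : (a, a') ∈ s.2) (hb : (b, b') ∈ t.2)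
    (hnear : |175488 * (x + z + s.1.1 - t.1.1) + 132472 * (x + y) +
      100000 * (y + s.1.2 - t.1.2)| ≤ 1300100) :
    Reachable (x + z + s.1.1 - t.1.1) (x + y) (y + s.1.2 - t.1.2) a' b' := by
  obtain ⟨x', y', z', hx, hy, hz, hbit⟩ := h
  obtain ⟨⟨hx₁, hx₂⟩, ⟨hy₁, hy₂⟩, hz₁, hz₂⟩ := bounds_of_pairBit_reachableMask hbit
  have htb := pairTransitions_sum_le ht
  obtain ⟨r, hr, c, hc, e, he, rfl, rfl, rfl, hm⟩ := exists_mem_of_pairBit_reachableMask hbit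
  have h := List.all_eq_true.1 (List.all_eq_true.1
    (List.all_eq_true.1 closedEntry_reachableTable r hr) c hc) e he
  have h := List.all_eq_true.1 (List.all_eq_true.1 h s hs) t ht
  have hn : nearKernel (r.1 + e.1 + s.1.1 - (t.1.1 + 20)) (r.1 + c.1 - 20)
      (c.1 + s.1.2 - t.1.2) = true := by
    simp only [nearKernel, Bool.and_eq_true, Nat.ble_eq]
    rw [abs_le] at hnear
    omega
  rw [hn, cond_true] at h
  have h := List.all_eq_true.1 (List.all_eq_true.1 h _ ha) _ hb
  rw [hm, hbit, cond_true] at h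
  exact ⟨_, _, _, by omega, by omega, by omega, h⟩

theorem Reachable.balanced {x y z : ℤ} {a b : ℕ} (h : Reachable x y z a b)
    {s t : (ℕ × ℕ) × List ℕ} (hs : s ∈ pairCodingPrefixes) (ht : t ∈ pairCodingPrefixes)
    (ha : a ∈ s.2) (hb : b ∈ t.2) (hlen : 3 * x + y + 2 * z + (s.1.1 - t.1.1) = 0) :
    x + y + z + (s.1.2 - t.1.2) ≤ 3 := by
  obtain ⟨x', y', z', hx, hy, hz, hbit⟩ := h
  have hsb := pairCodingPrefixes_length_le hs
  have htb := pairCodingPrefixes_length_le ht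
  obtain ⟨r, hr, c, hc, e, he, rfl, rfl, rfl, hm⟩ := exists_mem_of_pairBit_reachableMask hbit
  have h := List.all_eq_true.1 (List.all_eq_true.1
    (List.all_eq_true.1 balancedEntry_reachableTable r hr) c hc) e he
  have hl : (Nat.ble 116 (3 * r.1 + c.1 + 2 * e.1) && Nat.ble (3 * r.1 + c.1 + 2 * e.1) 124)
      = true := by
    simp only [Bool.and_eq_true, Nat.ble_eq]
    omega
  rw [balancedEntry, hl, cond_true] at h
  have h := List.all_eq_true.1 (List.all_eq_true.1 h s hs) t ht
  have hq : Nat.beq (3 * r.1 + c.1 + 2 * e.1 + s.1.1) (120 + t.1.1) = true := by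
    rw [Nat.beq_eq]
    omega
  rw [hq, cond_true, Bool.or_eq_true, Nat.ble_eq] at h
  rcases h with h | h
  · omega
  · have h := List.all_eq_true.1 (List.all_eq_true.1 h _ ha) _ hb
    rw [hm, hbit] at h
    simp at h

theorem applyMorph_eq_getD {k : ℕ} {A : Type*} [Inhabited A] (σ : Fin k → List A) (x : ℕ → Fin k)
    {n m r : ℕ} (hm : m ≤ n) (hr : r < (σ (x m)).length)
    (hn : n = ((List.range m).map fun i => σ (x i)).flatten.length + r) :
    applyMorph σ x n = (σ (x m)).getD r default := by
  obtain ⟨d, hd⟩ : ∃ d, n + 1 = (m + 1) + d := ⟨n - m, by omega⟩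
  rw [applyMorph, hd, List.range_add, List.map_append, List.flatten_append, List.range_succ,
    List.map_append, List.flatten_append, List.append_assoc,
    List.getD_append_right _ _ _ _ (by omega), hn, Nat.add_sub_cancel_left]
  simp [List.getElem?_append_left, hr]

/-- Every prefix of `applyMorph σ x` is the image of a prefix of `x` followed by a proper prefix of
the image of the next letter. -/
theorem exists_prefix_applyMorph {k : ℕ} {A : Type*} [Inhabited A] (σ : Fin k → List A)
    (hσ : ∀ a, σ a ≠ []) (x : ℕ → Fin k) (n : ℕ) :
    ∃ m r, m ≤ n ∧ r < (σ (x m)).length ∧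
      (List.range n).map (applyMorph σ x) =
        ((List.range m).map fun i => σ (x i)).flatten ++ (σ (x m)).take r ∧
      applyMorph σ x n = (σ (x m)).getD r default := by
  induction n with
  | zero =>
    have h : 0 < (σ (x 0)).length := List.length_pos_iff.2 (hσ _)
    exact ⟨0, 0, le_rfl, h, by simp, applyMorph_eq_getD σ x le_rfl h (by simp)⟩
  | succ n ih =>
    obtain ⟨m, r, hm, hr, hw, hl⟩ := ih
    have hlen := congrArg List.length hw
    rw [List.length_map, List.length_range, List.length_append, List.length_take,
      min_eq_left hr.le] at hlen
    have hw' : (List.range (n + 1)).map (applyMorph σ x) =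
        ((List.range m).map fun i => σ (x i)).flatten ++ (σ (x m)).take (r + 1) := by
      rw [List.range_succ, List.map_append, hw, List.append_assoc, List.take_add_one]
      simp [hl, hr]
    rcases Nat.lt_or_ge (r + 1) (σ (x m)).length with h | h
    · exact ⟨m, r + 1, by omega, h, hw', applyMorph_eq_getD σ x (by omega) h (by omega)⟩
    · have hpos : 0 < (σ (x (m + 1))).length := List.length_pos_iff.2 (hσ _)
      have hflat : ((List.range (m + 1)).map fun i => σ (x i)).flatten =
          ((List.range m).map fun i => σ (x i)).flatten ++ σ (x m) := by
        simp [List.range_succ]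
      refine ⟨m + 1, 0, by omega, hpos, ?_, applyMorph_eq_getD σ x (by omega) hpos ?_⟩
      · rw [hw', hflat, List.take_of_length_le h, List.take_zero, List.append_nil]
      · rw [hflat, List.length_append]
        omega

/-- The number of occurrences of the letter `a` in the prefix of length `n` of `x`. -/
def prefixCount {A : Type*} [DecidableEq A] (x : ℕ → A) (a : A) (n : ℕ) : ℕ :=
  ((List.range n).map x).count a

theorem count_FactorAt_add {A : Type*} [DecidableEq A] (x : ℕ → A) (a : A) (i n : ℕ) :
    prefixCount x a i + (FactorAt x i n).count a = prefixCount x a (i + n) := by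
  simp [prefixCount, FactorAt, List.range_add, Function.comp_def]

theorem count_flatten_map {A : Type*} [DecidableEq A] (σ : Fin 3 → List A) (x : ℕ → Fin 3)
    (a : A) (m : ℕ) :
    ((List.range m).map fun i => σ (x i)).flatten.count a =
      ∑ b, (σ b).count a * prefixCount x b m := by
  induction m with
  | zero => simp [prefixCount]
  | succ m ih =>
    have h : ∀ b, prefixCount x b (m + 1) = prefixCount x b m + if x m = b then 1 else 0 := by
      intro b
      simp [prefixCount, List.range_succ, List.count_singleton]
    simp [List.range_succ, ih, h, mul_add, Finset.sum_add_distrib]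

/-- A transition of the prefix automaton of `h`: the letter `a` leads, reading a proper prefix of
`h(a)` with `d₀` letters `0` and `d₂` letters `2`, to the letter `b` following that prefix. -/
def PrefixTransition (a : Fin 3) (d₀ d₂ : ℕ) (b : Fin 3) : Prop :=
  (a, d₀, d₂, b) ∈ [((0 : Fin 3), 0, 0, (0 : Fin 3)), (0, 1, 0, 1), (1, 0, 0, 2), (1, 0, 1, 1),
    (2, 0, 0, 0)]

/-- The word `g(a)` has a proper prefix of length `l` with `d` letters `0`. -/
def CodingPrefix (a : Fin 3) (l d : ℕ) : Prop :=
  (a, l, d) ∈ [((0 : Fin 3), 0, 0), (0, 1, 1), (0, 2, 1), (1, 0, 0), (2, 0, 0), (2, 1, 1)]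

theorem exists_parent {p : ℕ → Fin 3} (hp0 : p 0 = 0) (hpfix : applyMorph hm p = p) (n : ℕ) :
    ∃ m d₀ d₂, (m < n ∨ n = 0 ∧ m = 0) ∧ PrefixTransition (p m) d₀ d₂ (p n) ∧
      prefixCount p 0 n = prefixCount p 0 m + prefixCount p 2 m + d₀ ∧
      prefixCount p 1 n = prefixCount p 0 m + prefixCount p 1 m ∧
      prefixCount p 2 n = prefixCount p 1 m + d₂ := by
  obtain ⟨m, r, hmn, hr, hw, hl⟩ := exists_prefix_applyMorph hm (by decide) p n
  rw [hpfix] at hw hl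
  have hlt : m < n ∨ n = 0 ∧ m = 0 := by
    rcases Nat.eq_zero_or_pos m with rfl | hpos
    · omega
    · left
      have hlen := congrArg List.length hw
      have h : ∀ j, j + 2 ≤ ((List.range (j + 1)).map fun i => hm (p i)).flatten.length := by
        intro j
        induction j with
        | zero => simp [hp0, hm]
        | succ j ih =>
          have : ∀ a, 1 ≤ (hm a).length := by decide
          have := this (p (j + 1))
          rw [List.range_succ, List.map_append, List.flatten_append, List.length_append]
          simp only [List.map_cons, List.map_nil, List.flatten_cons, List.flatten_nil,
            List.append_nil]
          omega
      have := h (m - 1)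
      rw [Nat.sub_add_cancel hpos] at this
      rw [List.length_map, List.length_range, List.length_append] at hlen
      omega
  have hcount : ∀ a, prefixCount p a n =
      ∑ b, (hm b).count a * prefixCount p b m + ((hm (p m)).take r).count a := by
    intro a
    rw [← count_flatten_map, ← List.count_append, ← hw, prefixCount]
  have h : ∀ a : Fin 3, ∀ r < (hm a).length,
      PrefixTransition a (((hm a).take r).count 0) (((hm a).take r).count 2)
        ((hm a).getD r default) ∧ ((hm a).take r).count 1 = 0 := by
    unfold PrefixTransition
    decide
  obtain ⟨ht, h1⟩ := h (p m) r hr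
  rw [← hl] at ht
  refine ⟨m, _, _, hlt, ht, ?_, ?_, ?_⟩
  · rw [hcount, Fin.sum_univ_three]; simp [hm]
  · rw [hcount, h1, Fin.sum_univ_three]; simp [hm]
  · rw [hcount, Fin.sum_univ_three]; simp [hm]

theorem exists_coding_parent (p : ℕ → Fin 3) (n : ℕ) :
    ∃ m l d, CodingPrefix (p m) l d ∧
      n = 3 * prefixCount p 0 m + prefixCount p 1 m + 2 * prefixCount p 2 m + l ∧
      prefixCount (applyMorph gm p) 0 n =
        prefixCount p 0 m + prefixCount p 1 m + prefixCount p 2 m + d := by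
  obtain ⟨m, r, -, hr, hw, -⟩ := exists_prefix_applyMorph gm (by decide) p n
  have hcount : ∀ a, prefixCount (applyMorph gm p) a n =
      ∑ b, (gm b).count a * prefixCount p b m + ((gm (p m)).take r).count a := by
    intro a
    rw [← count_flatten_map, ← List.count_append, ← hw, prefixCount]
  have hn : prefixCount (applyMorph gm p) 0 n + prefixCount (applyMorph gm p) 1 n = n := by
    have h : ∀ l : List (Fin 2), l.count 0 + l.count 1 = l.length := by
      intro l
      induction l with
      | nil => rfl
      | cons a l ih => fin_cases a <;> simp <;> omega
    simpa [prefixCount] using h ((List.range n).map (applyMorph gm p))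
  have h : ∀ a : Fin 3, ∀ r < (gm a).length,
      CodingPrefix a (((gm a).take r).count 0 + ((gm a).take r).count 1)
        (((gm a).take r).count 0) := by
    unfold CodingPrefix
    decide
  rw [hcount, hcount, Fin.sum_univ_three, Fin.sum_univ_three] at hn
  refine ⟨m, _, _, h (p m) r hr, ?_, ?_⟩
  · simp [gm] at hn ⊢
    omega
  · rw [hcount, Fin.sum_univ_three]
    simp [gm]

theorem exists_dominant_eigenvalue :
    ∃ β : ℝ, 1.75487 ≤ β ∧ β ≤ 1.75488 ∧ β * (β - 1) ^ 2 = 1 := by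
  have hcont : ContinuousOn (fun t : ℝ => t * (t - 1) ^ 2) (Set.Icc 1.75487 1.75488) := by
    fun_prop
  obtain ⟨β, ⟨h₁, h₂⟩, h⟩ := intermediate_value_Icc (by norm_num) hcont
    (show (1 : ℝ) ∈ Set.Icc _ _ by constructor <;> norm_num)
  exact ⟨β, h₁, h₂, h⟩

/-- Bounds on the component of `(x, y, z)` in the contracted plane of the incidence matrix of `h`,
where `β` is the dominant eigenvalue. -/
structure ContractedBound (β x y z : ℝ) : Prop where
  fst : |y - β * z| ≤ 16.41
  snd : |x - (β - 1) * y| ≤ 12.9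
  next : |(2 - β) * (x - (β - 1) * y) - (β - 1) ^ 2 * (y - β * z)| ≤ 10.9

theorem abs_mul_le_of_le {a b c d : ℝ} (ha : |a| ≤ c) (hb : |b| ≤ d) : |a * b| ≤ c * d := by
  rw [abs_mul]
  exact mul_le_mul ha hb (abs_nonneg _) ((abs_nonneg _).trans ha)

theorem ContractedBound.step {β x y z b₀ b₂ : ℝ} (hβ₁ : 1.75487 ≤ β) (hβ₂ : β ≤ 1.75488)
    (hβ : β * (β - 1) ^ 2 = 1) (h : ContractedBound β x y z) (h₀ : |b₀| ≤ 2) (h₂ : |b₂| ≤ 2)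
    (h₀₂ : |b₀ + b₂| ≤ 2) : ContractedBound β (x + z + b₀) (x + y) (y + b₂) := by
  obtain ⟨hX, hY, hT⟩ := h
  have e₁ : x + y - β * (y + b₂) = (x - (β - 1) * y) - β * b₂ := by ring
  have e₂ : x + z + b₀ - (β - 1) * (x + y) =
      (2 - β) * (x - (β - 1) * y) - (β - 1) ^ 2 * (y - β * z) + b₀ := by
    linear_combination (-z) * hβ
  have e₃ : (2 - β) * (x + z + b₀ - (β - 1) * (x + y)) - (β - 1) ^ 2 * (x + y - β * (y + b₂)) =
      ((2 - β) ^ 2 - (β - 1) ^ 2) * (x - (β - 1) * y) - ((2 - β) * (β - 1) ^ 2) * (y - β * z) +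
        (2 - β) * b₀ + b₂ := by
    linear_combination (b₂ - (2 - β) * z) * hβ
  have hb : |β * b₂| ≤ 1.75488 * 2 := abs_mul_le_of_le (by rw [abs_le]; constructor <;> linarith) h₂
  have hA : |((2 - β) ^ 2 - (β - 1) ^ 2) * (x - (β - 1) * y)| ≤ 0.50976 * 12.9 :=
    abs_mul_le_of_le (by rw [abs_le]; constructor <;> nlinarith) hY
  have hB : |((2 - β) * (β - 1) ^ 2) * (y - β * z)| ≤ 0.1397 * 16.41 := by
    refine abs_mul_le_of_le ?_ hX
    have : (β - 1) ^ 2 ≤ 0.56985 := by nlinarith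
    rw [abs_le]
    constructor <;> nlinarith [sq_nonneg (β - 1)]
  have hC : |(2 - β) * b₀ + b₂| ≤ 2 := by
    rw [abs_le] at *
    constructor <;> nlinarith
  refine ⟨?_, ?_, ?_⟩
  · rw [e₁]
    rw [abs_le] at *
    constructor <;> linarith
  · rw [e₂]
    rw [abs_le] at *
    constructor <;> linarith
  · rw [e₃]
    rw [abs_le] at *
    constructor <;> linarith

theorem ContractedBound.abs_dominant_le {β x y z : ℝ} (hβ₁ : 1.75487 ≤ β) (hβ₂ : β ≤ 1.75488)
    (hβ : β * (β - 1) ^ 2 = 1) (h : ContractedBound β x y z) (hl : |3 * x + y + 2 * z| ≤ 4) :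
    |β * x + (β ^ 2 - β) * y + z| ≤ 13 := by
  obtain ⟨hX, hY, -⟩ := h
  have e : (2 * β ^ 2 - β) * (β * x + (β ^ 2 - β) * y + z) =
      (3 * β ^ 2 - 4 * β + 1) * (3 * x + y + 2 * z) -
      (((2 * β ^ 2 - β) - 2 * (3 * β ^ 2 - 4 * β + 1)) * (β - 1) ^ 2) * (y - β * z) -
      (6 * β ^ 2 - 10 * β + 1) * (x - (β - 1) * y) := by
    linear_combination ((4 * β ^ 2 - 7 * β + 2) * z + 2 * (x - (β - 1) * y)) * hβ
  have hA := abs_mul_le_of_le (a := 3 * β ^ 2 - 4 * β + 1) (c := 3.2195)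
    (by rw [abs_le]; constructor <;> nlinarith) hl
  have hB₁ : |(2 * β ^ 2 - β) - 2 * (3 * β ^ 2 - 4 * β + 1)| ≤ 2.0343 := by
    rw [abs_le]
    constructor <;> nlinarith
  have hB₂ : |(β - 1) ^ 2| ≤ 0.56985 := by
    rw [abs_le]
    constructor <;> nlinarith
  have hB := abs_mul_le_of_le (abs_mul_le_of_le hB₁ hB₂) hX
  have hC := abs_mul_le_of_le (a := 6 * β ^ 2 - 10 * β + 1) (c := 1.9295)
    (by rw [abs_le]; constructor <;> nlinarith) hY
  have hD : 4.404 ≤ 2 * β ^ 2 - β := by nlinarith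
  have hm : (2 * β ^ 2 - β) * |β * x + (β ^ 2 - β) * y + z| ≤ 4.404 * 13 := by
    rw [← abs_of_nonneg (show 0 ≤ 2 * β ^ 2 - β by linarith), ← abs_mul, e]
    rw [abs_le] at hA hB hC ⊢
    constructor <;> linarith
  nlinarith [abs_nonneg (β * x + (β ^ 2 - β) * y + z)]

/-- The parent of a vector on which the dominant eigenform is at most `13` has this property too. -/
theorem abs_dominant_parent_le {β x y z b₀ b₂ : ℝ} (hβ₁ : 1.75487 ≤ β)
    (hβ₂ : β ≤ 1.75488) (hβ : β * (β - 1) ^ 2 = 1) (h₀ : |b₀| ≤ 2) (h₀₂ : |b₀ + b₂| ≤ 2)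
    (h : |β * (x + z + b₀) + (β ^ 2 - β) * (x + y) + (y + b₂)| ≤ 13) :
    |β * x + (β ^ 2 - β) * y + z| ≤ 13 := by
  have e : β * (β * x + (β ^ 2 - β) * y + z) =
      (β * (x + z + b₀) + (β ^ 2 - β) * (x + y) + (y + b₂)) - (β * b₀ + b₂) := by
    linear_combination y * hβ
  have hb : |β * b₀ + b₂| ≤ 3.51 := by
    rw [abs_le] at *
    constructor <;> nlinarith
  have hm : β * |β * x + (β ^ 2 - β) * y + z| ≤ 16.51 := by
    have ha := abs_mul β (β * x + (β ^ 2 - β) * y + z)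
    rw [abs_of_nonneg (show 0 ≤ β by linarith), e] at ha
    rw [← ha]
    rw [abs_le] at *
    constructor <;> linarith
  nlinarith [abs_nonneg (β * x + (β ^ 2 - β) * y + z)]

theorem near_of_abs_dominant_le {β : ℝ} {x y z : ℤ} (hβ₁ : 1.75487 ≤ β)
    (hβ₂ : β ≤ 1.75488) (hx : |x| ≤ 20) (hy : |y| ≤ 20)
    (h : |β * x + (β ^ 2 - β) * y + z| ≤ 13) :
    |175488 * x + 132472 * y + 100000 * z| ≤ 1300100 := by
  have hx' : |(x : ℝ)| ≤ 20 := by exact_mod_cast hx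
  have hy' : |(y : ℝ)| ≤ 20 := by exact_mod_cast hy
  have h₁ : |(175488 - 100000 * β) * x| ≤ 1 * 20 :=
    abs_mul_le_of_le (by rw [abs_le]; constructor <;> linarith) hx'
  have h₂ : |(132472 - 100000 * (β ^ 2 - β)) * y| ≤ 3 * 20 :=
    abs_mul_le_of_le (by rw [abs_le]; constructor <;> nlinarith) hy'
  have : |175488 * (x : ℝ) + 132472 * y + 100000 * z| ≤ 1300100 := by
    rw [abs_le] at *
    constructor <;> linarith
  exact_mod_cast this

/-- The signed sum over four prefixes of `p` of the number of occurrences of a letter. -/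
def prefixDiff (p : ℕ → Fin 3) (a : Fin 3) (i j k l : ℕ) : ℤ :=
  (prefixCount p a i + prefixCount p a j : ℤ) - (prefixCount p a k + prefixCount p a l)

theorem PrefixTransition.exists_pair {a b c d : Fin 3} {s₀ s₂ t₀ t₂ : ℕ}
    (hs : PrefixTransition a s₀ s₂ b) (ht : PrefixTransition c t₀ t₂ d) :
    ∃ u ∈ pairTransitions, u.1 = (s₀ + t₀, s₂ + t₂) ∧
      (pairCode a c, pairCode b d) ∈ u.2 := by
  have h : ∀ s ∈ [((0 : Fin 3), 0, 0, (0 : Fin 3)), (0, 1, 0, 1), (1, 0, 0, 2), (1, 0, 1, 1),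
      (2, 0, 0, 0)], ∀ t ∈ [((0 : Fin 3), 0, 0, (0 : Fin 3)), (0, 1, 0, 1), (1, 0, 0, 2),
      (1, 0, 1, 1), (2, 0, 0, 0)], ∃ u ∈ pairTransitions,
      u.1 = (s.2.1 + t.2.1, s.2.2.1 + t.2.2.1) ∧
      (pairCode s.1 t.1, pairCode s.2.2.2 t.2.2.2) ∈ u.2 := by decide
  exact h _ hs _ ht

theorem CodingPrefix.exists_pair {a b : Fin 3} {l d l' d' : ℕ}
    (hs : CodingPrefix a l d) (ht : CodingPrefix b l' d') :
    ∃ u ∈ pairCodingPrefixes, u.1 = (l + l', d + d') ∧ pairCode a b ∈ u.2 := by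
  have h : ∀ s ∈ [((0 : Fin 3), 0, 0), (0, 1, 1), (0, 2, 1), (1, 0, 0), (2, 0, 0), (2, 1, 1)],
      ∀ t ∈ [((0 : Fin 3), 0, 0), (0, 1, 1), (0, 2, 1), (1, 0, 0), (2, 0, 0), (2, 1, 1)],
      ∃ u ∈ pairCodingPrefixes, u.1 = (s.2.1 + t.2.1, s.2.2 + t.2.2) ∧
      pairCode s.1 t.1 ∈ u.2 := by decide
  exact h _ hs _ ht

theorem prefixDiff_spec {p : ℕ → Fin 3} (hp0 : p 0 = 0) (hpfix : applyMorph hm p = p) {β : ℝ}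
    (hβ₁ : 1.75487 ≤ β) (hβ₂ : β ≤ 1.75488) (hβ : β * (β - 1) ^ 2 = 1) (N : ℕ) :
    ∀ i j k l, i + j + k + l = N →
      ContractedBound β (prefixDiff p 0 i j k l) (prefixDiff p 1 i j k l)
        (prefixDiff p 2 i j k l) ∧
      (|β * prefixDiff p 0 i j k l + (β ^ 2 - β) * prefixDiff p 1 i j k l +
        prefixDiff p 2 i j k l| ≤ 13 →
        Reachable (prefixDiff p 0 i j k l) (prefixDiff p 1 i j k l) (prefixDiff p 2 i j k l)
          (pairCode (p i) (p j)) (pairCode (p k) (p l))) := by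
  induction N using Nat.strong_induction_on with
  | _ N ih =>
    intro i j k l hN
    rcases Nat.eq_zero_or_pos N with h0 | hpos
    · obtain ⟨rfl, rfl, rfl, rfl⟩ : i = 0 ∧ j = 0 ∧ k = 0 ∧ l = 0 := by omega
      have hd : ∀ a, prefixDiff p a 0 0 0 0 = 0 := by simp [prefixDiff, prefixCount]
      rw [hd, hd, hd, hp0]
      exact ⟨⟨by norm_num, by norm_num, by norm_num⟩, fun _ => Reachable.zero⟩
    · obtain ⟨i', i₀, i₂, hi, hit, hi0, hi1, hi2⟩ := exists_parent hp0 hpfix i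
      obtain ⟨j', j₀, j₂, hj, hjt, hj0, hj1, hj2⟩ := exists_parent hp0 hpfix j
      obtain ⟨k', k₀, k₂, hk, hkt, hk0, hk1, hk2⟩ := exists_parent hp0 hpfix k
      obtain ⟨l', l₀, l₂, hl, hlt, hl0, hl1, hl2⟩ := exists_parent hp0 hpfix l
      obtain ⟨hcon, hreach⟩ := ih _ (by omega) i' j' k' l' rfl
      obtain ⟨s, hs, hse, hsm⟩ := hit.exists_pair hjt
      obtain ⟨t, ht, hte, htm⟩ := hkt.exists_pair hlt
      have hsb := pairTransitions_sum_le hs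
      have htb := pairTransitions_sum_le ht
      have e0 : prefixDiff p 0 i j k l =
          prefixDiff p 0 i' j' k' l' + prefixDiff p 2 i' j' k' l' + s.1.1 - t.1.1 := by
        simp only [prefixDiff, hi0, hj0, hk0, hl0, hse, hte]
        push_cast
        ring
      have e1 : prefixDiff p 1 i j k l =
          prefixDiff p 0 i' j' k' l' + prefixDiff p 1 i' j' k' l' := by
        simp only [prefixDiff, hi1, hj1, hk1, hl1]
        push_cast
        ring
      have e2 : prefixDiff p 2 i j k l =
          prefixDiff p 1 i' j' k' l' + s.1.2 - t.1.2 := by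
        simp only [prefixDiff, hi2, hj2, hk2, hl2, hse, hte]
        push_cast
        ring
      generalize prefixDiff p 0 i' j' k' l' = x at *
      generalize prefixDiff p 1 i' j' k' l' = y at *
      generalize prefixDiff p 2 i' j' k' l' = z at *
      rw [e0, e1, e2]
      obtain ⟨b₀, hb₀⟩ : ∃ b₀ : ℤ, b₀ = s.1.1 - t.1.1 := ⟨_, rfl⟩
      obtain ⟨b₂, hb₂⟩ : ∃ b₂ : ℤ, b₂ = s.1.2 - t.1.2 := ⟨_, rfl⟩
      have h₀ : |b₀| ≤ 2 := by rw [abs_le]; omega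
      have h₂ : |b₂| ≤ 2 := by rw [abs_le]; omega
      have h₀₂ : |b₀ + b₂| ≤ 2 := by rw [abs_le]; omega
      have h₀' : |(b₀ : ℝ)| ≤ 2 := by exact_mod_cast h₀
      have h₂' : |(b₂ : ℝ)| ≤ 2 := by exact_mod_cast h₂
      have h₀₂' : |(b₀ + b₂ : ℝ)| ≤ 2 := by exact_mod_cast h₀₂
      have c0 : ((x + z + s.1.1 - t.1.1 : ℤ) : ℝ) = x + z + b₀ := by
        rw [hb₀]; push_cast; ring
      have c1 : ((x + y : ℤ) : ℝ) = x + y := by push_cast; ring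
      have c2 : ((y + s.1.2 - t.1.2 : ℤ) : ℝ) = y + b₂ := by
        rw [hb₂]; push_cast; ring
      refine ⟨?_, fun hdom => ?_⟩
      · rw [c0, c1, c2]
        exact hcon.step hβ₁ hβ₂ hβ h₀' h₂' h₀₂'
      · have hdom' := hdom
        rw [c0, c1, c2] at hdom'
        have hR := hreach (abs_dominant_parent_le hβ₁ hβ₂ hβ h₀' h₀₂' hdom')
        have hbd := hR.bounds
        simp only [abs_le] at hbd
        exact hR.step hs ht hsm htm (near_of_abs_dominant_le hβ₁ hβ₂
          (by rw [abs_le]; omega) (by rw [abs_le]; omega) hdom)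

theorem count_FactorAt_le {p : ℕ → Fin 3} (hp0 : p 0 = 0) (hpfix : applyMorph hm p = p)
    (n i j : ℕ) : (FactorAt (applyMorph gm p) j n).count (0 : Fin 2) ≤
      (FactorAt (applyMorph gm p) i n).count (0 : Fin 2) + 3 := by
  obtain ⟨β, hβ₁, hβ₂, hβ⟩ := exists_dominant_eigenvalue
  have hi := count_FactorAt_add (applyMorph gm p) 0 i n
  have hj := count_FactorAt_add (applyMorph gm p) 0 j n
  obtain ⟨i₁, l₁, d₁, hc₁, hn₁, hz₁⟩ := exists_coding_parent p (j + n)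
  obtain ⟨i₂, l₂, d₂, hc₂, hn₂, hz₂⟩ := exists_coding_parent p i
  obtain ⟨i₃, l₃, d₃, hc₃, hn₃, hz₃⟩ := exists_coding_parent p (i + n)
  obtain ⟨i₄, l₄, d₄, hc₄, hn₄, hz₄⟩ := exists_coding_parent p j
  obtain ⟨s, hs, hse, hsm⟩ := hc₁.exists_pair hc₂
  obtain ⟨t, ht, hte, htm⟩ := hc₃.exists_pair hc₄
  have hsb := pairCodingPrefixes_length_le hs
  have htb := pairCodingPrefixes_length_le ht
  obtain ⟨hcon, hreach⟩ := prefixDiff_spec hp0 hpfix hβ₁ hβ₂ hβ _ i₁ i₂ i₃ i₄ rfl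
  have hlen : 3 * prefixDiff p 0 i₁ i₂ i₃ i₄ + prefixDiff p 1 i₁ i₂ i₃ i₄ +
      2 * prefixDiff p 2 i₁ i₂ i₃ i₄ + (s.1.1 - t.1.1) = 0 := by
    simp only [prefixDiff, hse, hte]
    omega
  have hl : |3 * prefixDiff p 0 i₁ i₂ i₃ i₄ + prefixDiff p 1 i₁ i₂ i₃ i₄ +
      2 * prefixDiff p 2 i₁ i₂ i₃ i₄| ≤ 4 := by
    rw [abs_le]
    omega
  have hbal := (hreach (hcon.abs_dominant_le hβ₁ hβ₂ hβ (by exact_mod_cast hl))).balanced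
    hs ht hsm htm hlen
  simp only [prefixDiff, hse, hte] at hbal
  omega

theorem abelianComplexity_le_of_count_le {x : ℕ → Fin 2} {n d : ℕ}
    (h : ∀ i j, (FactorAt x j n).count 0 ≤ (FactorAt x i n).count 0 + d) :
    abelianComplexity x n ≤ d + 1 := by
  classical
  have hex : ∃ z, ∃ i, z = (FactorAt x i n).count 0 := ⟨_, 0, rfl⟩
  obtain ⟨i, hi⟩ := Nat.find_spec hex
  have hsub : {z : ℕ | ∃ i, z = (FactorAt x i n).count 0} ⊆
      Finset.Icc (Nat.find hex) (Nat.find hex + d) := by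
    rintro z ⟨j, hj⟩
    have h₁ := Nat.find_min' hex ⟨j, hj⟩
    have h₂ := h i j
    simp only [Finset.coe_Icc, Set.mem_Icc]
    omega
  calc abelianComplexity x n ≤ _ := Set.ncard_le_ncard hsub (Finset.finite_toSet _)
    _ = d + 1 := by rw [Set.ncard_coe_finset, Nat.card_Icc]; omega

/-- The counts of `0`'s among the length-`n` factors of `q = g(p)` never contain two
values `x` and `y` with `y = x + 4`; equivalently, the abelian complexity of `q` never
takes a value of `5` or more. -/
theorem stmt16 (p : ℕ → Fin 3) (hp0 : p 0 = 0) (hpfix : applyMorph hm p = p) :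
    (∀ n i j : ℕ,
      (FactorAt (applyMorph gm p) j n).count (0 : Fin 2) ≠
        (FactorAt (applyMorph gm p) i n).count (0 : Fin 2) + 4) ∧
    (∀ n : ℕ, abelianComplexity (applyMorph gm p) n ≤ 4) := by
  exact ⟨fun n i j h => by have := count_FactorAt_le hp0 hpfix n i j; omega,
    fun n => abelianComplexity_le_of_count_le (count_FactorAt_le hp0 hpfix n)⟩
end
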